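/- arXiv:1002.4739 — 2 statements merged into one kernel-verified Lean document; each statement's English description precedes it below -/
import Mathlib

section
/- Let G be a 3-edge-connected cubic graph, and let e be an edge of G not contained in any cyclic 3-edge-cut, such that G − e is not matching-covered. Then there exists an edge f of G, vertex-disjoint from e, such that the graph G − {e, f} is matching-covered. -/
open SimpleGraph
open scoped Classical

universe u

variable {V : Type u}

/-- `M` is a perfect matching of `G`: a set of edges of `G` such that every
vertex is incident to exactly one edge of `M`. -/
def IsPM (G : SimpleGraph V) (M : Set (Sym2 V)) : Prop :=
  M ⊆ G.edgeSet ∧ ∀ v : V, ∃! e, e ∈ M ∧ v ∈ e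

/-- The edge-cut `E(A, Aᶜ)`: edges of `G` with one end in `A` and one end outside. -/
def cutEdges (G : SimpleGraph V) (A : Set V) : Set (Sym2 V) :=
  {e | e ∈ G.edgeSet ∧ ∃ x y, e = s(x, y) ∧ x ∈ A ∧ y ∉ A}

/-- The edge-cut `E(A, Aᶜ)` is cyclic: both sides induce a subgraph with a cycle. -/
def CyclicCut (G : SimpleGraph V) (A : Set V) : Prop :=
  ¬(G.induce A).IsAcyclic ∧ ¬(G.induce Aᶜ).IsAcyclic

/-- `G` has no cyclic edge-cut of size less than `k`. -/
def CyclicallyEdgeConnected (G : SimpleGraph V) (k : ℕ) : Prop :=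
  ∀ A : Set V, CyclicCut G A → k ≤ (cutEdges G A).ncard

/-- Every edge-cut of `G` has at least `k` edges. -/
def EdgeConnectedGe (G : SimpleGraph V) (k : ℕ) : Prop :=
  ∀ A : Set V, A.Nonempty → Aᶜ.Nonempty → k ≤ (cutEdges G A).ncard

/-- `G` is cubic: every vertex has degree three. -/
def CubicGraph (G : SimpleGraph V) : Prop :=
  ∀ v : V, (G.neighborSet v).ncard = 3

/-- `G` has no bridges. -/
def Bridgeless (G : SimpleGraph V) : Prop :=
  ∀ e ∈ G.edgeSet, ¬G.IsBridge e

/-- `G` is matching-covered: connected and every edge lies in a perfect matching. -/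
def MatchingCovered (G : SimpleGraph V) : Prop :=
  G.Connected ∧ ∀ e ∈ G.edgeSet, ∃ M, IsPM G M ∧ e ∈ M

/-- `M` is a matching of the subgraph of `G` induced on `A` which covers exactly the
vertices of `A \ X` (i.e. covers all vertices of `A` except those in `X`). -/
def IsNearPM (G : SimpleGraph V) (A X : Set V) (M : Set (Sym2 V)) : Prop :=
  (∀ e ∈ M, ∃ x y, e = s(x, y) ∧ G.Adj x y ∧ x ∈ A ∧ y ∈ A) ∧
  (∀ w ∈ A \ X, ∃! e, e ∈ M ∧ w ∈ e) ∧
  (∀ w ∈ X, ∀ e ∈ M, w ∉ e)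

/-- `IsTwistedNet G st c`: the subgraph of `G` induced on the vertex set `st` is a
twisted net with corner set `c`.  A 4-cycle is a twisted net whose corners are its
four vertices; and one may join a twisted net and a twisted net (multiplication), or
a twisted net and a single edge (incrementation), by two edges between corners. -/
inductive IsTwistedNet (G : SimpleGraph V) : Set V → Set V → Prop
  | cyc4 (a b c d : V) (hab : a ≠ b) (hac : a ≠ c) (had : a ≠ d)
      (hbc : b ≠ c) (hbd : b ≠ d) (hcd : c ≠ d)
      (hadj : ∀ x ∈ ({a, b, c, d} : Set V), ∀ y ∈ ({a, b, c, d} : Set V),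
        (G.Adj x y ↔ s(x, y) ∈ ({s(a, b), s(b, c), s(c, d), s(d, a)} : Set (Sym2 V)))) :
      IsTwistedNet G {a, b, c, d} {a, b, c, d}
  | incr (st c : Set V) (u u' v v' : V)
      (hprev : IsTwistedNet G st c)
      (hu : u ∈ c) (hu' : u' ∈ c) (huu' : u ≠ u')
      (hv : v ∉ st) (hv' : v' ∉ st) (hvv' : v ≠ v')
      (hvv'adj : G.Adj v v') (huv : G.Adj u v) (hu'v' : G.Adj u' v')
      (hcross : ∀ x ∈ st, (G.Adj x v ↔ x = u) ∧ (G.Adj x v' ↔ x = u')) :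
      IsTwistedNet G (st ∪ {v, v'}) ((c \ {u, u'}) ∪ {v, v'})
  | mult (st₁ c₁ st₂ c₂ : Set V) (u u' v v' : V)
      (h₁ : IsTwistedNet G st₁ c₁) (h₂ : IsTwistedNet G st₂ c₂)
      (hdisj : st₁ ∩ st₂ = ∅)
      (hu : u ∈ c₁) (hu' : u' ∈ c₁) (huu' : u ≠ u')
      (hv : v ∈ c₂) (hv' : v' ∈ c₂) (hvv' : v ≠ v')
      (huv : G.Adj u v) (hu'v' : G.Adj u' v')
      (hcross : ∀ x ∈ st₁, ∀ y ∈ st₂,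
        (G.Adj x y ↔ ((x = u ∧ y = v) ∨ (x = u' ∧ y = v')))) :
      IsTwistedNet G (st₁ ∪ st₂) ((c₁ \ {u, u'}) ∪ (c₂ \ {v, v'}))

/-- The set of (vertex sets of) semiblocks of `G`: inclusion-wise minimal sides of
2-edge-cuts. -/
def Semiblocks (G : SimpleGraph V) : Set (Set V) :=
  {A | A.Nonempty ∧ (cutEdges G A).ncard = 2 ∧
    ∀ A' ⊆ A, A'.Nonempty → (cutEdges G A').ncard = 2 → A' = A}

/-- The number of semiblocks of `G`; if `G` has no 2-edge-cut, `G` itself is its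
unique semiblock, so the number of semiblocks is `1` in this case. -/
noncomputable def numSemiblocks (G : SimpleGraph V) : ℕ :=
  max 1 (Semiblocks G).ncard

/-- The side `B` of a cyclic 4-edge-cut is solid if `G[B]` has no 2-edge-cut with at
least two vertices on each side. -/
def SolidSide (G : SimpleGraph V) (B : Set V) : Prop :=
  ¬∃ X ⊆ B, 2 ≤ X.ncard ∧ 2 ≤ (B \ X).ncard ∧
      ({e | e ∈ G.edgeSet ∧ ∃ x y, e = s(x, y) ∧ x ∈ X ∧ y ∈ B \ X}).ncard = 2

/-- The subgraph of `G` induced on `A` is a ladder (a `2 × k` grid) whose two ends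
(the edges both of whose end-vertices have degree two in the ladder) are `f₁` and `f₂`. -/
def IsLadder (G : SimpleGraph V) (A : Set V) (f₁ f₂ : Sym2 V) : Prop :=
  ∃ (k : ℕ) (x y : Fin (k + 1) → V),
    Function.Injective x ∧ Function.Injective y ∧ (∀ i j, x i ≠ y j) ∧
    A = Set.range x ∪ Set.range y ∧
    (∀ u ∈ A, ∀ v ∈ A, (G.Adj u v ↔
      ((∃ i, u = x i ∧ v = y i) ∨ (∃ i, u = y i ∧ v = x i) ∨
       (∃ i : Fin k, (u = x i.castSucc ∧ v = x i.succ) ∨ (u = x i.succ ∧ v = x i.castSucc) ∨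
         (u = y i.castSucc ∧ v = y i.succ) ∨ (u = y i.succ ∧ v = y i.castSucc))))) ∧
    f₁ = s(x 0, y 0) ∧ f₂ = s(x (Fin.last k), y (Fin.last k))

/-- The subgraph of `G` induced on `A` is a cycle of length four. -/
def Is4Cycle (G : SimpleGraph V) (A : Set V) : Prop :=
  ∃ a b c d : V, a ≠ b ∧ a ≠ c ∧ a ≠ d ∧ b ≠ c ∧ b ≠ d ∧ c ≠ d ∧
    A = {a, b, c, d} ∧
    G.Adj a b ∧ G.Adj b c ∧ G.Adj c d ∧ G.Adj d a ∧ ¬G.Adj a c ∧ ¬G.Adj b d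

/-- The graph `G_{(pq)}` obtained from `G[A]` by adding a new vertex (`Sum.inr 0`)
adjacent to `p` and `q`, a new vertex (`Sum.inr 1`) adjacent to `r` and `t`, and an
edge between the two new vertices. -/
def GExt (G : SimpleGraph V) (A : Set V) (p q r t : V) : SimpleGraph (↥A ⊕ Fin 2) :=
  SimpleGraph.fromRel (fun x y =>
    (∃ u v : A, x = Sum.inl u ∧ y = Sum.inl v ∧ G.Adj u v) ∨
    (∃ u : A, x = Sum.inr 0 ∧ y = Sum.inl u ∧ ((u : V) = p ∨ (u : V) = q)) ∨
    (∃ u : A, x = Sum.inr 1 ∧ y = Sum.inl u ∧ ((u : V) = r ∨ (u : V) = t)) ∨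
    (x = Sum.inr 0 ∧ y = Sum.inr 1))

/-- Perfect matching, as a finite edge set. -/
def IsPMF (G : SimpleGraph V) (M : Finset (Sym2 V)) : Prop :=
  (↑M : Set (Sym2 V)) ⊆ G.edgeSet ∧ ∀ v : V, ∃! e, e ∈ M ∧ v ∈ e

/-- `w` lies in the perfect matching polytope of `G`: it is a convex combination of
characteristic vectors of perfect matchings of `G`. -/
def InPMPolytope [Fintype V] [DecidableEq V] (G : SimpleGraph V) (w : Sym2 V → ℝ) : Prop :=
  ∃ μ : Finset (Sym2 V) → ℝ,
    (∀ M, 0 ≤ μ M) ∧ (∀ M, μ M ≠ 0 → IsPMF G M) ∧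
    (∑ M : Finset (Sym2 V), μ M) = 1 ∧
    ∀ e : Sym2 V, w e = ∑ M : Finset (Sym2 V), μ M * (if e ∈ M then 1 else 0)

/-- The components of `K - U` of odd size, or more generally a family of disjoint odd vertex sets
avoiding `U` which are joined by `K` only to themselves and to `U`. -/
structure IsOddFamily {W ι : Type u} (K : SimpleGraph W) (C : ι → Finset W) (U : Finset W) :
    Prop where
  disjoint : ∀ i j, i ≠ j → Disjoint (C i) (C j)
  odd : ∀ i, Odd (C i).card
  disjoint_right : ∀ i, Disjoint (C i) U
  closed : ∀ i, ∀ w ∈ C i, ∀ z, K.Adj w z → z ∈ C i ∨ z ∈ U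

lemma exists_isOddFamily_of_no_perfectMatching {W : Type u} [Fintype W] (K : SimpleGraph W)
    (heven : Even (Fintype.card W)) (hK : ¬∃ Q ≤ K, ∀ v, ∃! w, Q.Adj v w) :
    ∃ (ι : Type u) (_ : Fintype ι) (C : ι → Finset W) (U : Finset W),
      IsOddFamily K C U ∧ U.card + 2 ≤ Fintype.card ι := by
  have h1 : ¬∃ M : Subgraph K, M.IsPerfectMatching := by
    rintro ⟨M, hM⟩
    exact hK ⟨M.spanningCoe, M.spanningCoe_le, by
      simpa using Subgraph.isPerfectMatching_iff.1 hM⟩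
  rw [tutte] at h1
  push Not at h1
  obtain ⟨U, hU⟩ := h1
  unfold IsTutteViolator at hU
  set D := ((⊤ : K.Subgraph).deleteVerts U) with hD
  have hverts : D.verts = Uᶜ := by simp [hD, Set.compl_eq_univ_sdiff]
  have hpar := odd_ncard_oddComponents D.coe
  have hcard : Nat.card D.verts + U.ncard = Fintype.card W := by
    rw [Nat.card_coe_set_eq, hverts, add_comm, Set.ncard_add_ncard_compl, Nat.card_eq_fintype_card]
  rw [hverts] at hcard
  refine ⟨D.coe.oddComponents, inferInstance,
    fun c => c.1.supp.toFinset.map ⟨_, Subtype.val_injective⟩,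
    U.toFinset, ⟨?_, ?_, ?_, ?_⟩, ?_⟩
  · intro i j hij
    rw [Finset.disjoint_left]
    intro a ha hb
    simp only [Finset.mem_map, Set.mem_toFinset, Function.Embedding.coeFn_mk,
      ConnectedComponent.mem_supp_iff] at ha hb
    obtain ⟨x, hx, rfl⟩ := ha
    obtain ⟨y, hy, hxy⟩ := hb
    obtain rfl := Subtype.val_injective hxy
    exact hij (Subtype.ext (hx.symm.trans hy))
  · intro i
    rw [Finset.card_map, ← Set.ncard_eq_toFinset_card']
    exact i.2
  · intro i
    rw [Finset.disjoint_left]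
    intro a ha
    simp only [Finset.mem_map, Set.mem_toFinset, Function.Embedding.coeFn_mk] at ha ⊢
    obtain ⟨x, -, rfl⟩ := ha
    have : x.1 ∈ Uᶜ := hverts.subset x.2
    simpa using this
  · intro i w hw z hwz
    simp only [Finset.mem_map, Set.mem_toFinset, Function.Embedding.coeFn_mk,
      ConnectedComponent.mem_supp_iff] at hw ⊢
    obtain ⟨x, hx, rfl⟩ := hw
    by_cases hz : z ∈ U
    · exact Or.inr hz
    · left
      have hz' : z ∈ D.verts := by rw [hverts]; exact hz
      refine ⟨⟨z, hz'⟩, ?_, rfl⟩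
      rw [← hx, ConnectedComponent.eq]
      refine Adj.reachable ?_
      have hx' := x.2
      simp only [hD, Subgraph.deleteVerts_verts] at hx' hz'
      simp only [Subgraph.coe_adj, hD, Subgraph.deleteVerts_adj]
      exact ⟨hz'.1, hz'.2, hx'.1, hx'.2, hwz.symm⟩
  · rw [← Set.ncard_eq_toFinset_card', ← Nat.card_eq_fintype_card, Nat.card_coe_set_eq]
    rw [Nat.card_congr (Equiv.setCongr hverts)] at hpar
    grind

/-- A graph in which the edge `ab` lies in no perfect matching has a Tutte-type barrier
containing both ends of `ab`. -/
lemma exists_isOddFamily_of_edge {W : Type u} [Fintype W] (K : SimpleGraph W)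
    (heven : Even (Fintype.card W)) {a b : W} (hab : K.Adj a b)
    (hK : ¬∃ Q ≤ K, Q.Adj a b ∧ ∀ v, ∃! w, Q.Adj v w) :
    ∃ (ι : Type u) (_ : Fintype ι) (C : ι → Finset W) (U : Finset W),
      IsOddFamily K C U ∧ a ∈ U ∧ b ∈ U ∧ U.card ≤ Fintype.card ι := by
  let K' : SimpleGraph W :=
    { Adj := fun w z => K.Adj w z ∧ ((w = a ∨ w = b ∨ z = a ∨ z = b) →
        (w = a ∧ z = b) ∨ (w = b ∧ z = a))
      symm := ⟨fun w z h => ⟨h.1.symm, by have := h.2; tauto⟩⟩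
      loopless := ⟨fun w h => K.loopless.irrefl w h.1⟩ }
  have hK' : ¬∃ Q ≤ K', ∀ v, ∃! w, Q.Adj v w := by
    rintro ⟨Q, hQ, hM⟩
    refine hK ⟨Q, fun w z h => (hQ h).1, ?_, hM⟩
    obtain ⟨w, hw, -⟩ := hM a
    rcases (hQ hw).2 (Or.inl rfl) with h | h
    · rwa [← h.2]
    · exact absurd h.1 hab.ne
  obtain ⟨ι, _, C, U, hC, hcard⟩ := exists_isOddFamily_of_no_perfectMatching K' heven hK'
  have hclosed : ∀ i, ∀ w ∈ C i, ∀ z, K.Adj w z → w ≠ a → w ≠ b →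
      z ∈ C i ∨ z ∈ U ∨ z = a ∨ z = b := by
    intro i w hw z hwz h1 h2
    by_cases h3 : z = a ∨ z = b
    · tauto
    · have := hC.closed i w hw z ⟨hwz, by tauto⟩
      tauto
  have hKab : K'.Adj a b := ⟨hab, by tauto⟩
  by_cases hout : a ∉ U ∧ b ∉ U
  · refine ⟨ι, inferInstance, fun i => C i \ {a, b}, insert a (insert b U), ⟨?_, ?_, ?_, ?_⟩,
      by simp, by simp, ?_⟩
    · intro i j hij
      exact (hC.disjoint i j hij).mono Finset.sdiff_subset Finset.sdiff_subset
    · intro i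
      have hi := hC.odd i
      by_cases ha : a ∈ C i
      · have hb : b ∈ C i := (hC.closed i a ha b hKab).resolve_right hout.2
        have : ({a, b} : Finset W) ⊆ C i := by
          intro x hx; simp at hx; rcases hx with rfl | rfl <;> assumption
        have h2 := Finset.card_sdiff_add_card_eq_card this
        rw [Finset.card_pair hab.ne] at h2
        grind
      · have hb : b ∉ C i := fun hb => ha ((hC.closed i b hb a hKab.symm).resolve_right hout.1)
        rwa [Finset.sdiff_eq_self_of_disjoint]
        simp [ha, hb]
    · intro i
      have := hC.disjoint_right i
      rw [Finset.disjoint_left] at this ⊢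
      intro x hx
      simp only [Finset.mem_sdiff, Finset.mem_insert, Finset.mem_singleton] at hx ⊢
      have := @this x hx.1
      tauto
    · intro i w hw z hwz
      simp only [Finset.mem_sdiff, Finset.mem_insert, Finset.mem_singleton] at hw ⊢
      have := hclosed i w hw.1 z hwz (by tauto) (by tauto)
      tauto
    · refine le_trans (Finset.card_insert_le _ _) ?_
      have := Finset.card_insert_le b U
      omega
  · have hsmall : (insert a (insert b U)).card ≤ U.card + 1 := by
      by_cases ha : a ∈ U
      · rw [Finset.insert_comm, Finset.insert_eq_of_mem ha]
        exact Finset.card_insert_le _ _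
      · have hb : b ∈ U := by tauto
        rw [Finset.insert_eq_of_mem hb]
        exact Finset.card_insert_le _ _
    have hone : Fintype.card {i // ¬(a ∉ C i ∧ b ∉ C i)} ≤ 1 := by
      rw [Fintype.card_le_one_iff]
      rintro ⟨i, hi⟩ ⟨j, hj⟩
      by_contra hne
      have hij : i ≠ j := fun h => hne (Subtype.ext h)
      have h1 := Finset.disjoint_left.1 (hC.disjoint i j hij)
      have h2 := fun k => Finset.disjoint_left.1 (hC.disjoint_right k)
      rw [not_and_or, not_not, not_not] at hi hj
      rcases hi with hi | hi <;> rcases hj with hj | hj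
      · exact h1 hi hj
      · exact hout ⟨h2 i hi, h2 j hj⟩
      · exact hout ⟨h2 j hj, h2 i hi⟩
      · exact h1 hi hj
    refine ⟨{i // a ∉ C i ∧ b ∉ C i}, inferInstance, fun i => C i, insert a (insert b U),
      ⟨?_, fun i => hC.odd i, ?_, ?_⟩, by simp, by simp, ?_⟩
    · intro i j hij
      exact hC.disjoint i j (fun h => hij (Subtype.ext h))
    · intro i
      have := hC.disjoint_right i
      have := i.2
      simp [*]
    · intro i w hw z hwz
      have h1 : w ≠ a := fun h => i.2.1 (h ▸ hw)
      have h2 : w ≠ b := fun h => i.2.2 (h ▸ hw)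
      have := hclosed i w hw z hwz h1 h2
      simp only [Finset.mem_insert]
      tauto
    · have := Fintype.card_subtype_compl (fun i => a ∉ C i ∧ b ∉ C i)
      have := Fintype.card_subtype_le (fun i => a ∉ C i ∧ b ∉ C i)
      omega

/-- The total weight of the ordered pairs in `A × B`. -/
def crossWeight {W : Type u} (m : W → W → ℕ) (A B : Finset W) : ℕ := ∑ a ∈ A, ∑ b ∈ B, m a b

section CrossWeight

variable {W : Type u} {m : W → W → ℕ} {A B C : Finset W}

lemma crossWeight_comm (hm : ∀ a b, m a b = m b a) (A B : Finset W) :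
    crossWeight m A B = crossWeight m B A := by
  unfold crossWeight
  rw [Finset.sum_comm]
  exact Finset.sum_congr rfl fun _ _ => Finset.sum_congr rfl fun _ _ => hm _ _

lemma crossWeight_union_left (h : Disjoint A B) :
    crossWeight m (A ∪ B) C = crossWeight m A C + crossWeight m B C :=
  Finset.sum_union h

lemma crossWeight_union_right (h : Disjoint B C) :
    crossWeight m A (B ∪ C) = crossWeight m A B + crossWeight m A C := by
  simp only [crossWeight, Finset.sum_union h, Finset.sum_add_distrib]

lemma crossWeight_add_compl [Fintype W] [DecidableEq W] (A B : Finset W) :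
    crossWeight m A B + crossWeight m A Bᶜ = crossWeight m A Finset.univ := by
  simp only [crossWeight, ← Finset.sum_add_distrib, Finset.sum_add_sum_compl]

lemma crossWeight_biUnion_left {ι : Type u} {s : Finset ι} {D : ι → Finset W}
    (h : ∀ i ∈ s, ∀ j ∈ s, i ≠ j → Disjoint (D i) (D j)) :
    crossWeight m (s.biUnion D) B = ∑ i ∈ s, crossWeight m (D i) B :=
  Finset.sum_biUnion h

lemma crossWeight_eq_zero (h : ∀ a ∈ A, ∀ b ∈ B, m a b = 0) : crossWeight m A B = 0 :=
  Finset.sum_eq_zero fun a ha => Finset.sum_eq_zero fun b hb => h a ha b hb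

lemma crossWeight_eq_of_subset (h : B ⊆ C) (h0 : ∀ a ∈ A, ∀ b ∈ C, b ∉ B → m a b = 0) :
    crossWeight m A B = crossWeight m A C :=
  Finset.sum_congr rfl fun a ha => Finset.sum_subset h (h0 a ha)

lemma crossWeight_univ [Fintype W] (hreg : ∀ a, ∑ b, m a b = 3) (A : Finset W) :
    crossWeight m A Finset.univ = 3 * A.card := by
  simp [crossWeight, hreg, mul_comm]

lemma sum_le_crossWeight {T : Finset (W × W)} (hT : T ⊆ A ×ˢ B) :
    ∑ p ∈ T, m p.1 p.2 ≤ crossWeight m A B := by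
  rw [crossWeight, ← Finset.sum_product']
  exact Finset.sum_le_sum_of_subset hT

lemma two_le_crossWeight_self (hm : ∀ a b, m a b = m b a) {a b : W} (hne : a ≠ b)
    (hab : 0 < m a b) (ha : a ∈ A) (hb : b ∈ A) : 2 ≤ crossWeight m A A := by
  have h := sum_le_crossWeight (m := m) (A := A) (B := A) (T := {(a, b), (b, a)}) (by
    intro p hp
    simp only [Finset.mem_insert, Finset.mem_singleton] at hp
    rcases hp with rfl | rfl <;> simp [ha, hb])
  rw [Finset.sum_pair (by simp [hne])] at h
  have := hm a b
  simp only at h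
  omega

end CrossWeight

namespace IsOddFamily

variable {W ι : Type u} {K : SimpleGraph W} {C : ι → Finset W}
  {U : Finset W} {m : W → W → ℕ}

lemma disjoint_biUnion (h : IsOddFamily K C U) (s : Finset ι) : Disjoint (s.biUnion C) U := by
  rw [Finset.disjoint_biUnion_left]
  exact fun i _ => h.disjoint_right i

lemma crossWeight_compl [Fintype W] (h : IsOddFamily K C U)
    (hmK : ∀ a b, 0 < m a b → K.Adj a b) (i : ι) :
    crossWeight m (C i) U = crossWeight m (C i) (C i)ᶜ := by
  refine crossWeight_eq_of_subset ?_ ?_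
  · intro x hx
    rw [Finset.mem_compl]
    exact fun hx' => Finset.disjoint_left.1 (h.disjoint_right i) hx' hx
  · intro a ha b hb hbU
    by_contra hne
    rcases h.closed i a ha b (hmK a b (Nat.pos_of_ne_zero hne)) with h1 | h1
    · exact (Finset.mem_compl.1 hb) h1
    · exact hbU h1

lemma sum_crossWeight [Fintype W] [Fintype ι] (h : IsOddFamily K C U) (hm : ∀ a b, m a b = m b a)
    (hmK : ∀ a b, 0 < m a b → K.Adj a b) :
    ∑ i, crossWeight m (C i) (C i)ᶜ + crossWeight m U U
      + crossWeight m (Finset.univ.biUnion C ∪ U)ᶜ U = crossWeight m U Finset.univ := by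
  rw [← crossWeight_add_compl U (Finset.univ.biUnion C ∪ U),
    crossWeight_union_right (h.disjoint_biUnion _), crossWeight_comm hm U (Finset.univ.biUnion C),
    crossWeight_comm hm U (Finset.univ.biUnion C ∪ U)ᶜ,
    crossWeight_biUnion_left fun i _ j _ => h.disjoint i j,
    Finset.sum_congr rfl fun i _ => h.crossWeight_compl hmK i]

end IsOddFamily

/-- In a cubic weighted graph of even order all of whose odd cuts have weight at least three,
every edge lies in a perfect matching. -/
lemma exists_perfectMatching_of_weight {W : Type u} [Fintype W] {m : W → W → ℕ}
    (hm : ∀ a b, m a b = m b a) (hdiag : ∀ a, m a a = 0) (hreg : ∀ a, ∑ b, m a b = 3)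
    (heven : Even (Fintype.card W))
    (hcut : ∀ A : Finset W, Odd A.card → 3 ≤ crossWeight m A Aᶜ) {a b : W} (hab : 0 < m a b) :
    ∃ Q : SimpleGraph W, (∀ w z, Q.Adj w z → 0 < m w z) ∧ Q.Adj a b ∧ ∀ v, ∃! w, Q.Adj v w := by
  let K : SimpleGraph W :=
    { Adj := fun w z => 0 < m w z
      symm := ⟨fun w z h => by rwa [hm]⟩
      loopless := ⟨fun w h => by simp [hdiag] at h⟩ }
  by_contra hno
  obtain ⟨ι, _, C, U, hC, ha, hb, hcard⟩ := exists_isOddFamily_of_edge K heven (a := a) (b := b) hab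
    (fun ⟨Q, hQ, h⟩ => hno ⟨Q, fun _ _ h => hQ h, h⟩)
  have h1 := hC.sum_crossWeight hm (fun _ _ h => h)
  rw [crossWeight_univ hreg] at h1
  have h2 : ∑ _i : ι, 3 ≤ ∑ i, crossWeight m (C i) (C i)ᶜ :=
    Finset.sum_le_sum fun i _ => hcut _ (hC.odd i)
  have hne : a ≠ b := fun h => by simp [h, hdiag] at hab
  have h3 := two_le_crossWeight_self hm hne hab ha hb
  simp at h2
  omega

/-- The adjacency matrix of `G` with natural number entries. -/
noncomputable def adjWeight {W : Type u} (G : SimpleGraph W) (a b : W) : ℕ :=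
  if G.Adj a b then 1 else 0

section AdjWeight

variable {W : Type u} {G : SimpleGraph W}

lemma adjWeight_comm (a b : W) : adjWeight G a b = adjWeight G b a := by
  simp [adjWeight, G.adj_comm]

lemma adjWeight_pos {a b : W} : 0 < adjWeight G a b ↔ G.Adj a b := by
  unfold adjWeight; split_ifs <;> simp [*]

lemma adjWeight_self (a : W) : adjWeight G a a = 0 := by simp [adjWeight]

lemma sum_adjWeight [Fintype W] (hG : CubicGraph G) (a : W) : ∑ b, adjWeight G a b = 3 := by
  rw [← hG a, Set.ncard_eq_toFinset_card']
  simp only [adjWeight, Finset.sum_boole, Nat.cast_id]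
  congr 1
  ext; simp

lemma crossWeight_adjWeight [Fintype W] (A : Finset W) :
    crossWeight (adjWeight G) A Aᶜ = (cutEdges G (A : Set W)).ncard := by
  have h : cutEdges G (A : Set W) =
      (((A ×ˢ Aᶜ).filter fun p => G.Adj p.1 p.2).image fun p => s(p.1, p.2) : Finset (Sym2 W)) := by
    ext e
    simp only [cutEdges, Set.mem_ofPred_eq, Finset.coe_image, Set.mem_image, Finset.mem_coe,
      Finset.mem_filter, Finset.mem_product, Finset.mem_compl, Prod.exists]
    constructor
    · rintro ⟨he, x, y, rfl, hx, hy⟩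
      exact ⟨x, y, ⟨⟨hx, hy⟩, he⟩, rfl⟩
    · rintro ⟨x, y, ⟨⟨hx, hy⟩, he⟩, rfl⟩
      exact ⟨he, x, y, rfl, hx, hy⟩
  rw [h, Set.ncard_coe_finset, Finset.card_image_of_injOn, Finset.card_filter, Finset.sum_product]
  · rfl
  · rintro ⟨a, b⟩ hab ⟨c, d⟩ hcd heq
    simp only [Finset.coe_filter, Finset.mem_product, Finset.mem_compl, Set.mem_ofPred_eq]
      at hab hcd
    simp only [Sym2.eq_iff] at heq
    rcases heq with ⟨rfl, rfl⟩ | ⟨rfl, rfl⟩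
    · rfl
    · exact absurd hab.1.1 hcd.1.2

lemma crossWeight_deleteEdge {x y : W} (hxy : G.Adj x y) (A B : Finset W) :
    crossWeight (adjWeight G) A B = crossWeight (adjWeight (G.deleteEdges {s(x, y)})) A B
      + ((if x ∈ A ∧ y ∈ B then 1 else 0) + if y ∈ A ∧ x ∈ B then 1 else 0) := by
  have h1 : ∀ p q : W, (if p ∈ A ∧ q ∈ B then 1 else 0) =
      ∑ a ∈ A, ∑ b ∈ B, if a = p ∧ b = q then 1 else 0 := by
    intro p q
    simp [ite_and, Finset.sum_ite_eq']
  rw [h1 x y, h1 y x]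
  simp only [crossWeight, ← Finset.sum_add_distrib]
  refine Finset.sum_congr rfl fun a _ => Finset.sum_congr rfl fun b _ => ?_
  have hne := hxy.ne
  have hyx := hxy.symm
  simp only [adjWeight, deleteEdges_adj, Set.mem_singleton_iff, Sym2.eq_iff]
  by_cases ha : a = x ∧ b = y
  · obtain ⟨rfl, rfl⟩ := ha
    simp [hxy, hne]
  · by_cases hb : a = y ∧ b = x
    · obtain ⟨rfl, rfl⟩ := hb
      simp [hyx, hne.symm]
    · simp [ha, hb]

end AdjWeight

/-- `Q` is a matching of `G[C]` covering all of `C` but the vertex `c`. -/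
structure IsNearMatching (G : SimpleGraph V) (C : Finset V) (c : V) (Q : SimpleGraph V) :
    Prop where
  le : Q ≤ G
  mem : ∀ v w, Q.Adj v w → v ∈ C ∧ v ≠ c
  existsUnique : ∀ v ∈ C, v ≠ c → ∃! w, Q.Adj v w

/-- The weighted graph obtained from `G` by contracting the complement of `C` to a vertex. -/
noncomputable def contractWeight [Fintype V] (G : SimpleGraph V) (C : Finset V) :
    Option C → Option C → ℕ
  | none, none => 0
  | none, some c => ∑ z ∈ Cᶜ, adjWeight G c z
  | some c, none => ∑ z ∈ Cᶜ, adjWeight G c z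
  | some c, some d => adjWeight G c d

section Contract

variable [Fintype V] {G : SimpleGraph V} {C : Finset V}

lemma contractWeight_comm (a b : Option C) :
    contractWeight G C a b = contractWeight G C b a := by
  cases a <;> cases b <;> simp only [contractWeight]
  exact adjWeight_comm _ _

lemma contractWeight_self (a : Option C) : contractWeight G C a a = 0 := by
  cases a <;> simp [contractWeight, adjWeight_self]

lemma sum_contractWeight (hG : CubicGraph G) (hC : crossWeight (adjWeight G) C Cᶜ = 3)
    (a : Option C) : ∑ b, contractWeight G C a b = 3 := by
  rw [Fintype.sum_option]
  cases a with
  | none =>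
    simp only [contractWeight, zero_add]
    rw [← hC, crossWeight, ← Finset.sum_coe_sort C]
  | some c =>
    simp only [contractWeight]
    rw [Finset.sum_coe_sort C (fun z => adjWeight G c z), add_comm, Finset.sum_add_sum_compl,
      sum_adjWeight hG]

lemma three_le_crossWeight_contractWeight (hG : CubicGraph G)
    (hcut : ∀ A : Finset V, Odd A.card → 3 ≤ crossWeight (adjWeight G) A Aᶜ)
    (hC : crossWeight (adjWeight G) C Cᶜ = 3) (hodd : Odd C.card) (A : Finset (Option C))
    (hA : Odd A.card) : 3 ≤ crossWeight (contractWeight G C) A Aᶜ := by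
  have key : ∀ B : Finset (Option C), Odd B.card → none ∉ B →
      3 ≤ crossWeight (contractWeight G C) B Bᶜ := by
    intro B hB hnone
    set B' := (Finset.eraseNone B).map (Function.Embedding.subtype _) with hB'
    have hBeq : B = (Finset.eraseNone B).map Function.Embedding.some := by
      rw [Finset.map_some_eraseNone, Finset.erase_eq_of_notMem hnone]
    have hcard : B'.card = B.card := by
      rw [hB', Finset.card_map]; conv_rhs => rw [hBeq, Finset.card_map]
    have hself : crossWeight (contractWeight G C) B B = crossWeight (adjWeight G) B' B' := by
      rw [hBeq, hB']
      simp only [crossWeight, Finset.sum_map]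
      simp [contractWeight]
    have h1 := crossWeight_add_compl (m := contractWeight G C) B B
    have h2 := crossWeight_add_compl (m := adjWeight G) B' B'
    rw [crossWeight_univ (sum_contractWeight hG hC)] at h1
    rw [crossWeight_univ (sum_adjWeight hG)] at h2
    have h3 := hcut B' (hcard ▸ hB)
    rw [hcard] at h2
    omega
  by_cases hnone : none ∈ A
  · rw [crossWeight_comm contractWeight_comm]
    have := key Aᶜ
    rw [compl_compl] at this
    refine this ?_ (by simpa using hnone)
    have h1 := Finset.card_add_card_compl A
    rw [Fintype.card_option, Fintype.card_coe] at h1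
    grind
  · exact key A hA hnone

lemma exists_isNearMatching_of_contractWeight (hG : CubicGraph G)
    (hcut : ∀ A : Finset V, Odd A.card → 3 ≤ crossWeight (adjWeight G) A Aᶜ)
    (hC : crossWeight (adjWeight G) C Cᶜ = 3) (hodd : Odd C.card) {a b : Option C}
    (hab : 0 < contractWeight G C a b) :
    ∃ P : SimpleGraph (Option C), P.Adj a b ∧ (∀ v, ∃! w, P.Adj v w) ∧
      ∀ c : C, P.Adj none (some c) → (∃ s ∉ C, G.Adj c s) ∧
        ∃ Q, IsNearMatching G C c Q ∧ ∀ w z : C, P.Adj (some w) (some z) → Q.Adj w z := by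
  obtain ⟨P, hP, hPab, hPM⟩ := exists_perfectMatching_of_weight contractWeight_comm
    contractWeight_self (sum_contractWeight hG hC)
    (by rw [Fintype.card_option, Fintype.card_coe]; grind)
    (fun A hA => by convert three_le_crossWeight_contractWeight hG hcut hC hodd A hA) hab
  refine ⟨P, hPab, hPM, fun c hc => ⟨?_, ?_⟩⟩
  · have h := hP _ _ hc
    simp only [contractWeight] at h
    obtain ⟨s, hs, h⟩ := Finset.exists_ne_zero_of_sum_ne_zero h.ne'
    exact ⟨s, Finset.mem_compl.1 hs, adjWeight_pos.1 (Nat.pos_of_ne_zero h)⟩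
  · refine ⟨
      { Adj := fun v w => ∃ (hv : v ∈ C) (hw : w ∈ C), P.Adj (some ⟨v, hv⟩) (some ⟨w, hw⟩)
        symm := ⟨fun v w ⟨hv, hw, h⟩ => ⟨hw, hv, h.symm⟩⟩
        loopless := ⟨fun v ⟨hv, hw, h⟩ => P.loopless.irrefl _ h⟩ }, ⟨?_, ?_, ?_⟩, ?_⟩
    · rintro v w ⟨hv, hw, h⟩
      exact adjWeight_pos.1 (hP _ _ h)
    · rintro v w ⟨hv, hw, h⟩
      refine ⟨hv, ?_⟩
      rintro rfl
      simpa using (hPM _).unique hc.symm h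
    · intro v hv hvc
      obtain ⟨w, hw, huniq⟩ := hPM (some ⟨v, hv⟩)
      cases w with
      | none =>
        have := (hPM none).unique hc hw.symm
        simp only [Option.some.injEq] at this
        exact absurd (congrArg Subtype.val this).symm hvc
      | some w =>
        refine ⟨w, ⟨hv, w.2, hw⟩, ?_⟩
        rintro z ⟨_, hz, h⟩
        have := huniq _ h
        simp only [Option.some.injEq] at this
        exact congrArg Subtype.val this
    · intro w z h
      exact ⟨w.2, z.2, h⟩

lemma exists_isNearMatching_of_adj_compl (hG : CubicGraph G)
    (hcut : ∀ A : Finset V, Odd A.card → 3 ≤ crossWeight (adjWeight G) A Aᶜ)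
    (hC : crossWeight (adjWeight G) C Cᶜ = 3) (hodd : Odd C.card) {c s : V} (hc : c ∈ C)
    (hs : s ∉ C) (hcs : G.Adj c s) : ∃ Q, IsNearMatching G C c Q := by
  obtain ⟨P, hP, -, h⟩ := exists_isNearMatching_of_contractWeight hG hcut hC hodd
    (a := none) (b := some ⟨c, hc⟩) (by
      simp only [contractWeight]
      exact Finset.sum_pos' (fun _ _ => Nat.zero_le _)
        ⟨s, Finset.mem_compl.2 hs, adjWeight_pos.2 hcs⟩)
  obtain ⟨-, Q, hQ, -⟩ := h ⟨c, hc⟩ hP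
  exact ⟨Q, hQ⟩

lemma exists_isNearMatching_of_adj (hG : CubicGraph G)
    (hcut : ∀ A : Finset V, Odd A.card → 3 ≤ crossWeight (adjWeight G) A Aᶜ)
    (hC : crossWeight (adjWeight G) C Cᶜ = 3) (hodd : Odd C.card) {a b : V} (ha : a ∈ C)
    (hb : b ∈ C) (hab : G.Adj a b) :
    ∃ c ∈ C, ∃ s ∉ C, G.Adj c s ∧ ∃ Q, IsNearMatching G C c Q ∧ Q.Adj a b := by
  obtain ⟨P, hP, hPM, h⟩ := exists_isNearMatching_of_contractWeight hG hcut hC hodd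
    (a := some ⟨a, ha⟩) (b := some ⟨b, hb⟩) (adjWeight_pos.2 hab)
  obtain ⟨c, hc, -⟩ := hPM none
  cases c with
  | none => exact absurd hc (P.loopless.irrefl _)
  | some c =>
    obtain ⟨⟨s, hs, hcs⟩, Q, hQ, hQP⟩ := h c hc
    exact ⟨c, c.2, s, hs, hcs, Q, hQ, hQP _ _ hP⟩

end Contract

lemma finite_of_edgeConnectedGe {G : SimpleGraph V} (hG : CubicGraph G)
    (h3 : EdgeConnectedGe G 3) : Finite V := by
  have hfin : ∀ v, (G.neighborSet v).Finite := fun v =>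
    Set.finite_of_ncard_ne_zero (by rw [hG v]; norm_num)
  have hnbr : ∀ v, ∃ w, G.Adj v w := fun v =>
    Set.nonempty_of_ncard_ne_zero (s := G.neighborSet v) (by rw [hG v]; norm_num)
  choose nbr hnbr using hnbr
  obtain ⟨A, hA⟩ := zorn_subset {A : Set V | ∀ v ∈ A, ∀ w ∈ A, ¬G.Adj v w} (by
    intro c hc hchain
    refine ⟨⋃₀ c, ?_, fun s hs => Set.subset_sUnion_of_mem hs⟩
    rintro v ⟨s, hs, hvs⟩ w ⟨t, ht, hwt⟩
    rcases hchain.total hs ht with hst | hst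
    · exact hc ht v (hst hvs) w hwt
    · exact hc hs v hvs w (hst hwt))
  have hind := hA.1
  have hdom : ∀ v ∉ A, ∃ w ∈ A, G.Adj w v := by
    intro v hv
    by_contra! hno
    refine hv (hA.2 (y := insert v A) ?_ (Set.subset_insert _ _) (Set.mem_insert _ _))
    rintro a (rfl | ha) b (rfl | hb)
    · exact G.loopless.irrefl _
    · exact fun h => hno b hb h.symm
    · exact hno a ha
    · exact hind a ha b hb
  by_contra hinf
  have hAinf : A.Infinite := by
    intro hAfin
    refine hinf (Set.finite_univ_iff.1 ((hAfin.union
      (hAfin.biUnion fun w _ => hfin w)).subset fun v _ => ?_))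
    by_cases hv : v ∈ A
    · exact Or.inl hv
    · obtain ⟨w, hw, hwv⟩ := hdom v hv
      exact Or.inr (Set.mem_biUnion hw hwv)
  obtain ⟨a, ha⟩ := hAinf.nonempty
  have hcutinf : (cutEdges G A).Infinite := by
    have hout : ∀ v ∈ A, nbr v ∉ A := fun v hv hw => hind v hv _ hw (hnbr v)
    refine Set.infinite_of_injOn_mapsTo (f := fun v => s(v, nbr v)) (s := A) ?_ ?_ hAinf
    · intro v hv w hw hvw
      simp only [Sym2.eq_iff] at hvw
      rcases hvw with h | h
      · exact h.1
      · exact absurd (h.1 ▸ hv) (hout w hw)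
    · intro v hv
      exact ⟨hnbr v, v, nbr v, rfl, hv, hout v hv⟩
  have := h3 A ⟨a, ha⟩ ⟨nbr a, fun h => hind a ha _ h (hnbr a)⟩
  rw [hcutinf.ncard] at this
  omega

lemma connected_deleteEdges {G : SimpleGraph V} [Nonempty V] (h3 : EdgeConnectedGe G 3)
    (D : Set (Sym2 V)) (hfin : D.Finite) (hD : D.ncard ≤ 2) : (G.deleteEdges D).Connected := by
  refine ⟨fun a b => ?_⟩
  by_contra hab
  have h := h3 {w | (G.deleteEdges D).Reachable a w} ⟨a, Reachable.refl _⟩ ⟨b, hab⟩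
  have hsub : cutEdges G {w | (G.deleteEdges D).Reachable a w} ⊆ D := by
    rintro _ ⟨he, x, y, rfl, hx, hy⟩
    by_contra hnot
    exact hy (Reachable.trans hx (Adj.reachable (deleteEdges_adj.2 ⟨he, hnot⟩)))
  have := Set.ncard_le_ncard hsub hfin
  omega

lemma isPM_edgeSet {G P : SimpleGraph V} (hP : P ≤ G) (hPM : ∀ v, ∃! w, P.Adj v w) :
    IsPM G P.edgeSet := by
  refine ⟨edgeSet_mono hP, fun v => ?_⟩
  obtain ⟨w, hw, huniq⟩ := hPM v
  refine ⟨s(v, w), ⟨hw, Sym2.mem_mk_left _ _⟩, ?_⟩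
  rintro e ⟨he, hve⟩
  obtain ⟨z, rfl⟩ := Sym2.mem_iff_exists.1 hve
  rw [huniq z he]

/-- Near-perfect matchings of the odd components and a system of edges to the barrier form a
perfect matching. -/
lemma exists_perfectMatching_of_isNearMatching {ι : Type u} [Fintype ι] {C : ι → Finset V}
    {U : Finset V} {K : SimpleGraph V} (hC : IsOddFamily K C U)
    (hcover : ∀ w ∉ U, ∃ i, w ∈ C i) (hcard : Fintype.card ι = U.card) {σ c : ι → V}
    (hσ : Function.Injective σ) (hσU : ∀ i, σ i ∈ U) (hc : ∀ i, c i ∈ C i)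
    (hadj : ∀ i, K.Adj (c i) (σ i)) {Q : ι → SimpleGraph V}
    (hQ : ∀ i, IsNearMatching K (C i) (c i) (Q i)) :
    ∃ P ≤ K, (∀ i, P.Adj (c i) (σ i)) ∧ (∀ i, Q i ≤ P) ∧ ∀ v, ∃! w, P.Adj v w := by
  have hCU : ∀ {i v}, v ∈ C i → v ∉ U := fun {i v} h =>
    Finset.disjoint_left.1 (hC.disjoint_right i) h
  have hCC : ∀ {i j v}, v ∈ C i → v ∈ C j → i = j := fun {i j v} h1 h2 => by
    by_contra hne
    exact Finset.disjoint_left.1 (hC.disjoint i j hne) h1 h2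
  have hsurj : ∀ v ∈ U, ∃ i, σ i = v := by
    have himg : Finset.univ.image σ = U := Finset.eq_of_subset_of_card_le
      (by intro v hv; obtain ⟨i, -, rfl⟩ := Finset.mem_image.1 hv; exact hσU i)
      (by rw [Finset.card_image_of_injective _ hσ, Finset.card_univ, hcard])
    intro v hv
    rw [← himg] at hv
    simpa using hv
  have hirr : ∀ i j, c i ≠ σ j := fun i j h => hCU (hc i) (h ▸ hσU j)
  refine ⟨
    { Adj := fun v w => (∃ i, (Q i).Adj v w) ∨ (∃ i, v = c i ∧ w = σ i) ∨ ∃ i, v = σ i ∧ w = c i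
      symm := ⟨?_⟩
      loopless := ⟨?_⟩ }, ?_, ?_, ?_, ?_⟩
  · rintro v w (⟨i, h⟩ | ⟨i, rfl, rfl⟩ | ⟨i, rfl, rfl⟩)
    · exact Or.inl ⟨i, h.symm⟩
    · exact Or.inr (Or.inr ⟨i, rfl, rfl⟩)
    · exact Or.inr (Or.inl ⟨i, rfl, rfl⟩)
  · rintro v (⟨i, h⟩ | ⟨i, rfl, h⟩ | ⟨i, rfl, h⟩)
    · exact (Q i).loopless.irrefl _ h
    · exact hirr _ _ h
    · exact hirr _ _ h.symm
  · rintro v w (⟨i, h⟩ | ⟨i, rfl, rfl⟩ | ⟨i, rfl, rfl⟩)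
    · exact (hQ i).le h
    · exact hadj i
    · exact (hadj i).symm
  · exact fun i => Or.inr (Or.inl ⟨i, rfl, rfl⟩)
  · exact fun i v w h => Or.inl ⟨i, h⟩
  · intro v
    by_cases hv : v ∈ U
    · obtain ⟨i, rfl⟩ := hsurj v hv
      refine ⟨c i, Or.inr (Or.inr ⟨i, rfl, rfl⟩), ?_⟩
      rintro w (⟨j, h⟩ | ⟨j, h, -⟩ | ⟨j, h, rfl⟩)
      · exact absurd hv (hCU ((hQ j).mem _ _ h).1)
      · exact absurd h.symm (hirr _ _)
      · rw [hσ h]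
    · obtain ⟨i, hi⟩ := hcover v hv
      by_cases hvc : v = c i
      · subst hvc
        refine ⟨σ i, Or.inr (Or.inl ⟨i, rfl, rfl⟩), ?_⟩
        rintro w (⟨j, h⟩ | ⟨j, h, rfl⟩ | ⟨j, h, -⟩)
        · obtain ⟨h1, h2⟩ := (hQ j).mem _ _ h
          exact absurd (congrArg c (hCC hi h1)) h2
        · rw [hCC hi (h ▸ hc j)]
        · exact absurd h (hirr _ _)
      · obtain ⟨w, hw, huniq⟩ := (hQ i).existsUnique v hi hvc
        refine ⟨w, Or.inl ⟨i, hw⟩, ?_⟩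
        rintro z (⟨j, h⟩ | ⟨j, rfl, -⟩ | ⟨j, rfl, -⟩)
        · obtain rfl := hCC hi ((hQ j).mem _ _ h).1
          exact huniq z h
        · exact absurd (congrArg c (hCC (hc j) hi)) hvc
        · exact absurd (hσU j) hv

section Finite

variable [Fintype V] {G : SimpleGraph V}

lemma even_card (hG : CubicGraph G) : Even (Fintype.card V) := by
  have h := G.sum_degrees_eq_twice_card_edges
  have hdeg : ∀ v, G.degree v = 3 := fun v => by
    rw [← hG v, Set.ncard_eq_toFinset_card']; rfl
  simp only [hdeg, Finset.sum_const, Finset.card_univ, smul_eq_mul] at h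
  grind

lemma card_le_one_of_isAcyclic (hG : CubicGraph G) {A : Finset V}
    (hA : (G.induce (A : Set V)).IsAcyclic) (hcut : crossWeight (adjWeight G) A Aᶜ = 3) :
    A.card ≤ 1 := by
  rcases A.eq_empty_or_nonempty with rfl | hne
  · simp
  obtain ⟨a, ha⟩ := hne
  have : Nonempty (A : Set V) := ⟨⟨a, ha⟩⟩
  obtain ⟨T, hT, -, htree⟩ := connected_top.exists_isTree_le_of_le_of_isAcyclic le_top hA
  have h1 := htree.card_edgeFinset
  have h2 := Finset.card_le_card (edgeFinset_mono hT)
  have h3 := (G.induce (A : Set V)).sum_degrees_eq_twice_card_edges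
  have h4 : crossWeight (adjWeight G) A A = ∑ v, (G.induce (A : Set V)).degree v := by
    rw [crossWeight, ← Finset.sum_coe_sort A]
    refine Finset.sum_congr rfl fun v _ => ?_
    rw [← Finset.sum_coe_sort A, ← card_neighborFinset_eq_degree]
    simp only [adjWeight, Finset.sum_boole, Nat.cast_id]
    congr 1
    ext; simp
  have h5 := crossWeight_add_compl (m := adjWeight G) A A
  rw [crossWeight_univ (sum_adjWeight hG)] at h5
  have h6 : Fintype.card (A : Set V) = A.card := by simp
  omega

/-- The structure of a barrier witnessing that the edge `uv` of `G - xy` lies in no perfect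
matching of `G - xy`. -/
lemma exists_barrier (hG : CubicGraph G)
    (hcut : ∀ A : Finset V, A.Nonempty → Aᶜ.Nonempty → 3 ≤ crossWeight (adjWeight G) A Aᶜ)
    {x y : V} (hxy : G.Adj x y)
    (htriv : ∀ A : Finset V, 1 < A.card → 1 < Aᶜ.card → crossWeight (adjWeight G) A Aᶜ = 3 →
      (x ∈ A ↔ y ∈ A))
    {u v : V} (huv : (G.deleteEdges {s(x, y)}).Adj u v)
    (hno : ¬∃ Q ≤ G.deleteEdges {s(x, y)}, Q.Adj u v ∧ ∀ v, ∃! w, Q.Adj v w) :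
    ∃ (ι : Type u) (_ : Fintype ι) (C : ι → Finset V) (U : Finset V),
      IsOddFamily (G.deleteEdges {s(x, y)}) C U ∧ u ∈ U ∧ v ∈ U ∧ Fintype.card ι = U.card ∧
      (∃ i, C i = {x}) ∧ (∃ i, C i = {y}) ∧ (∀ w ∉ U, ∃ i, w ∈ C i) ∧
      (∀ i, crossWeight (adjWeight G) (C i) (C i)ᶜ = 3) ∧
      ∀ w ∈ U, ∀ z ∈ U, (G.deleteEdges {s(x, y)}).Adj w z → s(w, z) = s(u, v) := by
  set K := G.deleteEdges {s(x, y)} with hK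
  obtain ⟨ι, _, C, U, hC, hu, hv, hcard⟩ := exists_isOddFamily_of_edge K (even_card hG) huv hno
  have hsum := hC.sum_crossWeight adjWeight_comm fun a b h => adjWeight_pos.1 h
  have hsplit : ∀ A B, crossWeight (adjWeight G) A B = crossWeight (adjWeight K) A B + _ :=
    crossWeight_deleteEdge hxy
  have hUuniv : crossWeight (adjWeight K) U Finset.univ ≤ 3 * U.card := by
    rw [← crossWeight_univ (sum_adjWeight hG) U, hsplit]
    exact Nat.le_add_right _ _
  have hUU := two_le_crossWeight_self adjWeight_comm huv.ne (adjWeight_pos.2 huv) hu hv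
  have hCU := fun i => Finset.disjoint_left.1 (hC.disjoint_right i)
  have hCne : ∀ i, (C i).Nonempty := fun i => Finset.card_pos.1 (hC.odd i).pos
  have hC3 : ∀ i, 3 ≤ crossWeight (adjWeight G) (C i) (C i)ᶜ := fun i =>
    hcut _ (hCne i) ⟨u, Finset.mem_compl.2 fun h => hCU i h hu⟩
  have hone : ∀ p q : V, ∑ i, (if p ∈ C i ∧ q ∈ (C i)ᶜ then 1 else 0) ≤ 1 := by
    intro p q
    rw [Finset.sum_boole, Nat.cast_id, Finset.card_le_one_iff]
    intro i j hi hj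
    by_contra hij
    simp only [Finset.mem_filter] at hi hj
    exact Finset.disjoint_left.1 (hC.disjoint i j hij) hi.2.1 hj.2.1
  have hex : ∀ p q : V, ∑ i, (if p ∈ C i ∧ q ∈ (C i)ᶜ then 1 else 0) = 1 →
      ∃ i, p ∈ C i ∧ q ∉ C i := by
    intro p q h
    obtain ⟨i, -, hi⟩ := Finset.exists_ne_zero_of_sum_ne_zero (h.trans_ne one_ne_zero)
    by_contra hno
    refine hi (if_neg fun h => hno ⟨i, h.1, Finset.mem_compl.1 h.2⟩)
  have hsumC : ∑ i, crossWeight (adjWeight G) (C i) (C i)ᶜ =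
      ∑ i, crossWeight (adjWeight K) (C i) (C i)ᶜ +
        (∑ i, (if x ∈ C i ∧ y ∈ (C i)ᶜ then 1 else 0) +
          ∑ i, (if y ∈ C i ∧ x ∈ (C i)ᶜ then 1 else 0)) := by
    rw [← Finset.sum_add_distrib, ← Finset.sum_add_distrib]
    exact Finset.sum_congr rfl fun i _ => hsplit _ _
  have hsum3 : ∑ _i : ι, 3 ≤ ∑ i, crossWeight (adjWeight G) (C i) (C i)ᶜ :=
    Finset.sum_le_sum fun i _ => hC3 i
  have hsum3' : ∑ _i : ι, 3 = 3 * Fintype.card ι := by simp [mul_comm]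
  have hx1 := hone x y
  have hy1 := hone y x
  have heq : ∑ _i : ι, 3 = ∑ i, crossWeight (adjWeight G) (C i) (C i)ᶜ := by omega
  have hall3 : ∀ i, crossWeight (adjWeight G) (C i) (C i)ᶜ = 3 := fun i =>
    ((Finset.sum_eq_sum_iff_of_le fun i _ => hC3 i).1 heq i (Finset.mem_univ i)).symm
  obtain ⟨ix, hix, hix'⟩ := hex x y (by omega)
  obtain ⟨iy, hiy, hiy'⟩ := hex y x (by omega)
  have hcompl : ∀ i, 1 < (C i)ᶜ.card := by
    intro i
    rw [Finset.one_lt_card]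
    exact ⟨u, Finset.mem_compl.2 fun h => hCU i h hu, v, Finset.mem_compl.2 fun h => hCU i h hv,
      huv.ne⟩
  have hsing : ∀ i p, p ∈ C i → ¬(x ∈ C i ↔ y ∈ C i) → C i = {p} := by
    intro i p hp hne
    have h1 : (C i).card ≤ 1 := by
      by_contra hlt
      exact hne (htriv _ (by omega) (hcompl i) (hall3 i))
    exact Finset.eq_singleton_iff_unique_mem.2 ⟨hp, fun q hq => Finset.card_le_one.1 h1 q hq p hp⟩
  refine ⟨ι, inferInstance, C, U, hC, hu, hv, by omega, ⟨ix, hsing ix x hix (by tauto)⟩,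
    ⟨iy, hsing iy y hiy (by tauto)⟩, ?_, hall3, ?_⟩
  · intro w hw
    by_contra hwC
    set O := (Finset.univ.biUnion C ∪ U)ᶜ with hO
    have hmemO : ∀ z, z ∈ O ↔ (∀ i, z ∉ C i) ∧ z ∉ U := by
      intro z
      simp [hO]
    have h3 := hcut O ⟨w, (hmemO w).2 ⟨fun i hi => hwC ⟨i, hi⟩, hw⟩⟩
      ⟨u, Finset.mem_compl.2 fun h => ((hmemO u).1 h).2 hu⟩
    have hxO : x ∉ O := fun h => ((hmemO x).1 h).1 ix hix
    have hyO : y ∉ O := fun h => ((hmemO y).1 h).1 iy hiy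
    have hOU : crossWeight (adjWeight K) O U = crossWeight (adjWeight K) O Oᶜ := by
      refine crossWeight_eq_of_subset
        (fun z hz => Finset.mem_compl.2 fun h => ((hmemO z).1 h).2 hz) ?_
      intro a ha b hb hbU
      by_contra hne
      have hab := adjWeight_pos.1 (Nat.pos_of_ne_zero hne)
      have hbi : ∃ i, b ∈ C i := by
        by_contra hno
        exact (Finset.mem_compl.1 hb) ((hmemO b).2 ⟨fun i hi => hno ⟨i, hi⟩, hbU⟩)
      obtain ⟨i, hi⟩ := hbi
      rcases hC.closed i b hi a hab.symm with h | h
      · exact ((hmemO a).1 ha).1 i h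
      · exact ((hmemO a).1 ha).2 h
    rw [hsplit, if_neg (by tauto), if_neg (by tauto)] at h3
    omega
  · intro w hw z hz hwz
    by_contra hne
    simp only [Sym2.eq_iff, not_or] at hne
    have h := sum_le_crossWeight (m := adjWeight K) (A := U) (B := U)
      (T := {(u, v), (v, u), (w, z)}) (by
        intro p hp
        simp only [Finset.mem_insert, Finset.mem_singleton] at hp
        rcases hp with rfl | rfl | rfl <;> simp [*])
    rw [Finset.sum_insert (by simp [huv.ne]; tauto), Finset.sum_pair (by simp; tauto)] at h
    have h1 := adjWeight_pos.2 huv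
    have h2 := adjWeight_pos.2 huv.symm
    have h3 := adjWeight_pos.2 hwz
    simp only at h
    omega

variable {ι : Type u} {C : ι → Finset V} {U : Finset V} {x y : V}

/-- Strict expansion in the bipartite graph between a barrier and its odd components. -/
lemma card_lt_card_neighbors (hG : CubicGraph G)
    (hcut : ∀ A : Finset V, A.Nonempty → Aᶜ.Nonempty → 3 ≤ crossWeight (adjWeight G) A Aᶜ)
    (hxy : G.Adj x y) (hC : IsOddFamily (G.deleteEdges {s(x, y)}) C U) (hx : x ∉ U) (hy : y ∉ U)
    (hC3 : ∀ i, crossWeight (adjWeight G) (C i) (C i)ᶜ = 3)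
    {s : Finset ι} (hs : s.Nonempty) {j : ι} (hj : j ∉ s) :
    s.card < (U.filter fun w => ∃ i ∈ s, ∃ c ∈ C i, (G.deleteEdges {s(x, y)}).Adj c w).card := by
  set K := G.deleteEdges {s(x, y)} with hK
  set N := U.filter fun w => ∃ i ∈ s, ∃ c ∈ C i, K.Adj c w with hN
  set P := s.biUnion C with hP
  have hsplit : ∀ A B, crossWeight (adjWeight G) A B = crossWeight (adjWeight K) A B + _ :=
    crossWeight_deleteEdge hxy
  have hCne : ∀ i, (C i).Nonempty := fun i => Finset.card_pos.1 (hC.odd i).pos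
  have hNU : N ⊆ U := Finset.filter_subset _ _
  have hPN : Disjoint P N := (hC.disjoint_biUnion s).mono_right hNU
  have hmemP : ∀ z, z ∈ P ↔ ∃ i ∈ s, z ∈ C i := fun z => Finset.mem_biUnion
  have hclosed : ∀ a ∈ P, ∀ b, K.Adj a b → b ∈ P ∨ b ∈ N := by
    intro a ha b hab
    obtain ⟨i, hi, hai⟩ := (hmemP a).1 ha
    rcases hC.closed i a hai b hab with h | h
    · exact Or.inl ((hmemP b).2 ⟨i, hi, h⟩)
    · exact Or.inr (Finset.mem_filter.2 ⟨h, i, hi, a, hai, hab⟩)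
  have hNx : x ∉ N := fun h => hx (hNU h)
  have hNy : y ∉ N := fun h => hy (hNU h)
  have hpos := hcut (P ∪ N) (by
      obtain ⟨i, hi⟩ := hs
      obtain ⟨c, hc⟩ := hCne i
      exact ⟨c, Finset.mem_union_left _ ((hmemP c).2 ⟨i, hi, hc⟩)⟩) (by
      obtain ⟨c, hc⟩ := hCne j
      refine ⟨c, Finset.mem_compl.2 fun h => ?_⟩
      rcases Finset.mem_union.1 h with h | h
      · obtain ⟨i, hi, hci⟩ := (hmemP c).1 h
        exact Finset.disjoint_left.1 (hC.disjoint i j fun h => hj (h ▸ hi)) hci hc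
      · exact Finset.disjoint_left.1 (hC.disjoint_right j) hc (hNU h))
  rw [crossWeight_union_left hPN, hsplit P, crossWeight_eq_zero (m := adjWeight K) (A := P)] at hpos
  swap
  · intro a ha b hb
    by_contra hne
    have := hclosed a ha b (adjWeight_pos.1 (Nat.pos_of_ne_zero hne))
    simp only [Finset.mem_compl, Finset.mem_union] at hb
    exact hb this
  have hNuniv := crossWeight_add_compl (m := adjWeight G) N (P ∪ N)
  rw [crossWeight_univ (sum_adjWeight hG), crossWeight_union_right hPN] at hNuniv
  have hNP : crossWeight (adjWeight G) N P = ∑ i ∈ s, crossWeight (adjWeight K) (C i) (C i)ᶜ := by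
    rw [crossWeight_comm adjWeight_comm, hsplit, if_neg (by tauto), if_neg (by tauto), add_zero,
      hP, crossWeight_biUnion_left fun i _ j _ => hC.disjoint i j]
    refine Finset.sum_congr rfl fun i hi => ?_
    rw [← hC.crossWeight_compl fun a b h => adjWeight_pos.1 h]
    refine crossWeight_eq_of_subset hNU fun a ha b hb hbN => ?_
    by_contra hne
    exact hbN (Finset.mem_filter.2 ⟨hb, i, hi, a, ha, adjWeight_pos.1 (Nat.pos_of_ne_zero hne)⟩)
  have hsum : ∑ i ∈ s, crossWeight (adjWeight G) (C i) (C i)ᶜ = 3 * s.card := by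
    simp [hC3, mul_comm]
  have hbound : ∀ p q : V, ∑ i ∈ s, (if p ∈ C i ∧ q ∈ (C i)ᶜ then 1 else 0) ≤
      if p ∈ P then 1 else 0 := by
    intro p q
    rw [Finset.sum_boole, Nat.cast_id]
    split_ifs with hp
    · rw [Finset.card_le_one_iff]
      intro i j hi hj
      by_contra hij
      simp only [Finset.mem_filter] at hi hj
      exact Finset.disjoint_left.1 (hC.disjoint i j hij) hi.2.1 hj.2.1
    · rw [Nat.le_zero, Finset.card_eq_zero, Finset.filter_eq_empty_iff]
      exact fun i hi h => hp ((hmemP p).2 ⟨i, hi, h.1⟩)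
  have hsumK : ∑ i ∈ s, crossWeight (adjWeight G) (C i) (C i)ᶜ =
      ∑ i ∈ s, crossWeight (adjWeight K) (C i) (C i)ᶜ +
        (∑ i ∈ s, (if x ∈ C i ∧ y ∈ (C i)ᶜ then 1 else 0) +
          ∑ i ∈ s, (if y ∈ C i ∧ x ∈ (C i)ᶜ then 1 else 0)) := by
    rw [← Finset.sum_add_distrib, ← Finset.sum_add_distrib]
    exact Finset.sum_congr rfl fun i _ => hsplit _ _
  have hbx := hbound x y
  have hby := hbound y x
  simp only [Finset.mem_compl, Finset.mem_union, hNx, hNy, or_false] at hpos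
  by_cases hxP : x ∈ P <;> by_cases hyP : y ∈ P <;> simp only [hxP, hyP, if_true, if_false,
    not_true, not_false_iff, and_true, and_false, and_self] at hpos hbx hby <;> omega

/-- Every edge between a barrier and an odd component extends to a perfect matching of the
bipartite graph between the barrier and its odd components. -/
lemma exists_injective_extending (hG : CubicGraph G)
    (hcut : ∀ A : Finset V, A.Nonempty → Aᶜ.Nonempty → 3 ≤ crossWeight (adjWeight G) A Aᶜ)
    (hxy : G.Adj x y) (hC : IsOddFamily (G.deleteEdges {s(x, y)}) C U) (hx : x ∉ U) (hy : y ∉ U)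
    (hC3 : ∀ i, crossWeight (adjWeight G) (C i) (C i)ᶜ = 3) (j : ι) {w : V} (hw : w ∈ U) :
    ∃ σ : ι → V, Function.Injective σ ∧ σ j = w ∧ (∀ i, σ i ∈ U) ∧
      ∀ i, i ≠ j → ∃ c ∈ C i, (G.deleteEdges {s(x, y)}).Adj c (σ i) := by
  set K := G.deleteEdges {s(x, y)} with hK
  let t : {i // i ≠ j} → Finset V := fun i =>
    U.filter fun z => z ≠ w ∧ ∃ c ∈ C i, K.Adj c z
  obtain ⟨σ, hσ, hσt⟩ := (Finset.all_card_le_biUnion_card_iff_exists_injective t).1 (by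
    intro s
    rcases s.eq_empty_or_nonempty with rfl | hs
    · simp
    have h := card_lt_card_neighbors hG hcut hxy hC hx hy hC3
      (s := s.map (Function.Embedding.subtype _)) (j := j) (by simpa using hs) (by simp)
    rw [Finset.card_map] at h
    have hsub : (U.filter fun z => ∃ i ∈ s.map (Function.Embedding.subtype _),
        ∃ c ∈ C i, K.Adj c z) ⊆ insert w (s.biUnion t) := by
      intro z hz
      simp only [Finset.mem_filter, Finset.mem_map, Function.Embedding.subtype_apply] at hz
      obtain ⟨hzU, _, ⟨i, hi, rfl⟩, hc⟩ := hz
      by_cases hzw : z = w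
      · exact Finset.mem_insert.2 (Or.inl hzw)
      · exact Finset.mem_insert_of_mem
          (Finset.mem_biUnion.2 ⟨i, hi, Finset.mem_filter.2 ⟨hzU, hzw, hc⟩⟩)
    have h1 := h.trans_le (Finset.card_le_card hsub)
    have h2 := Finset.card_insert_le w (s.biUnion t)
    omega)
  have hσ' := fun i => Finset.mem_filter.1 (hσt i)
  refine ⟨fun i => if h : i = j then w else σ ⟨i, h⟩, ?_, by simp, ?_, ?_⟩
  · intro a b hab
    by_cases ha : a = j <;> by_cases hb : b = j <;> simp only [ha, hb, dif_pos, dif_neg,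
      not_false_iff] at hab ⊢
    · exact absurd hab.symm (hσ' _).2.1
    · exact absurd hab (hσ' _).2.1
    · exact congrArg Subtype.val (hσ hab)
  · intro i
    by_cases h : i = j
    · simpa [h] using hw
    · simpa [h] using (hσ' ⟨i, h⟩).1
  · intro i h
    simpa [h] using (hσ' ⟨i, h⟩).2.2

/-- Every edge of `G - xy` meeting an odd component of the barrier lies in a perfect matching. -/
lemma exists_perfectMatching_of_mem_component [Fintype ι] (hG : CubicGraph G)
    (hcut : ∀ A : Finset V, A.Nonempty → Aᶜ.Nonempty → 3 ≤ crossWeight (adjWeight G) A Aᶜ)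
    (hxy : G.Adj x y) (hC : IsOddFamily (G.deleteEdges {s(x, y)}) C U)
    (hcard : Fintype.card ι = U.card) (hx : ∃ i, C i = {x}) (hy : ∃ i, C i = {y})
    (hcover : ∀ w ∉ U, ∃ i, w ∈ C i)
    (hC3 : ∀ i, crossWeight (adjWeight G) (C i) (C i)ᶜ = 3)
    {i : ι} {a b : V} (ha : a ∈ C i) (hab : (G.deleteEdges {s(x, y)}).Adj a b) :
    ∃ P ≤ G.deleteEdges {s(x, y)}, P.Adj a b ∧ ∀ v, ∃! w, P.Adj v w := by
  set K := G.deleteEdges {s(x, y)} with hK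
  obtain ⟨ix, hix⟩ := hx
  obtain ⟨iy, hiy⟩ := hy
  have hKG : K ≤ G := deleteEdges_le _
  have hCU : ∀ {i v}, v ∈ C i → v ∉ U := fun {i v} h =>
    Finset.disjoint_left.1 (hC.disjoint_right i) h
  have hsing : ∀ {i z}, z = x ∨ z = y → z ∈ C i → C i = {z} := by
    intro i z hz hzi
    have hmem : z ∈ C ix ∨ z ∈ C iy := by rcases hz with rfl | rfl <;> simp [hix, hiy]
    by_contra hne
    have h1 : ∀ j, z ∈ C j → i = j := fun j hj => by
      by_contra hij
      exact Finset.disjoint_left.1 (hC.disjoint i j hij) hzi hj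
    rcases hmem with h | h
    · obtain rfl := h1 _ h
      rw [hix, Finset.mem_singleton] at h
      exact hne (h ▸ hix)
    · obtain rfl := h1 _ h
      rw [hiy, Finset.mem_singleton] at h
      exact hne (h ▸ hiy)
  have hend : ∀ {p q : V}, s(p, q) = s(x, y) → p = x ∨ p = y := by
    intro p q h
    rw [Sym2.eq_iff] at h
    tauto
  have hnear : ∀ {j c Q}, IsNearMatching G (C j) c Q → IsNearMatching K (C j) c Q := by
    intro j c Q hQ
    refine ⟨fun p q h => deleteEdges_adj.2 ⟨hQ.le h, fun he => ?_⟩, hQ.mem, hQ.existsUnique⟩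
    have h1 := hsing (hend he) (hQ.mem _ _ h).1
    have h2 := (hQ.mem _ _ h.symm).1
    rw [h1, Finset.mem_singleton] at h2
    exact h.ne h2.symm
  have hneuniv : ∀ A : Finset V, Odd A.card → 3 ≤ crossWeight (adjWeight G) A Aᶜ := by
    intro A hA
    refine hcut A (Finset.card_pos.1 hA.pos) (Finset.card_pos.1 ?_)
    have h1 := Finset.card_add_card_compl A
    have h2 := even_card hG
    grind
  have hbdry : ∀ {j c z}, c ∈ C j → z ∈ U → K.Adj c z → ∃ Q, IsNearMatching K (C j) c Q := by
    intro j c z hcj hz hcz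
    obtain ⟨Q, hQ⟩ := exists_isNearMatching_of_adj_compl hG hneuniv (hC3 j) (hC.odd j) hcj
      (fun h => hCU h hz) (hKG hcz)
    exact ⟨Q, hnear hQ⟩
  have hstart : ∃ c ∈ C i, ∃ z ∈ U, K.Adj c z ∧
      ∃ Q, IsNearMatching K (C i) c Q ∧ (Q.Adj a b ∨ (a = c ∧ b = z)) := by
    rcases hC.closed i a ha b hab with hb | hb
    · obtain ⟨c, hc, z, hz, hcz, Q, hQ, hQab⟩ :=
        exists_isNearMatching_of_adj hG hneuniv (hC3 i) (hC.odd i) ha hb (hKG hab)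
      have hcz' : K.Adj c z := deleteEdges_adj.2 ⟨hcz, fun he => by
        have h1 := hsing (hend he) hc
        rw [h1, Finset.mem_singleton] at ha hb
        exact hab.ne (ha.trans hb.symm)⟩
      exact ⟨c, hc, z, (hC.closed i c hc z hcz').resolve_left hz, hcz', Q, hnear hQ, Or.inl hQab⟩
    · obtain ⟨Q, hQ⟩ := hbdry ha hb hab
      exact ⟨a, ha, b, hb, hab, Q, hQ, Or.inr ⟨rfl, rfl⟩⟩
  obtain ⟨c, hc, z, hz, hcz, Q, hQ, hQab⟩ := hstart
  obtain ⟨σ, hσ, hσi, hσU, hσC⟩ := exists_injective_extending hG hcut hxy hC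
    (hCU (hix ▸ Finset.mem_singleton_self x)) (hCU (hiy ▸ Finset.mem_singleton_self y)) hC3 i hz
  have hall : ∀ j, ∃ d, ∃ R, d ∈ C j ∧ K.Adj d (σ j) ∧ IsNearMatching K (C j) d R ∧
      (j = i → R.Adj a b ∨ (a = d ∧ b = σ j)) := by
    intro j
    by_cases hj : j = i
    · subst hj
      exact ⟨c, Q, hc, hσi ▸ hcz, hQ, fun _ => hσi ▸ hQab⟩
    · obtain ⟨d, hd, hdσ⟩ := hσC j hj
      obtain ⟨R, hR⟩ := hbdry hd (hσU j) hdσ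
      exact ⟨d, R, hd, hdσ, hR, fun h => absurd h hj⟩
  choose d R hd hdσ hR hRi using hall
  obtain ⟨P, hPK, hPσ, hPR, hPM⟩ :=
    exists_perfectMatching_of_isNearMatching hC hcover hcard hσ hσU hd hdσ hR
  refine ⟨P, hPK, ?_, hPM⟩
  rcases hRi i rfl with h | ⟨rfl, rfl⟩
  · exact hPR i h
  · exact hPσ i

end Finite

/-- Let `G` be a 3-edge-connected cubic graph and `e` an edge not contained in any
cyclic 3-edge-cut such that `G - e` is not matching-covered. Then there is an edge `f`
vertex-disjoint from `e` such that `G - {e, f}` is matching-covered. -/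
theorem exists_f_matching_covered
    (G : SimpleGraph V) (hcubic : CubicGraph G)
    (h3ec : EdgeConnectedGe G 3) (e : Sym2 V) (he : e ∈ G.edgeSet)
    (hnc : ∀ A : Set V, CyclicCut G A → (cutEdges G A).ncard = 3 →
      e ∉ cutEdges G A)
    (hnmc : ¬MatchingCovered (G.deleteEdges {e})) :
    ∃ f ∈ G.edgeSet, (∀ v : V, v ∈ e → v ∉ f) ∧
      MatchingCovered (G.deleteEdges {e, f}) := by
  have := finite_of_edgeConnectedGe hcubic h3ec
  have := Fintype.ofFinite V
  induction e with | h x y => ?_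
  have hxy : G.Adj x y := he
  have : Nonempty V := ⟨x⟩
  have hcut : ∀ A : Finset V, A.Nonempty → Aᶜ.Nonempty → 3 ≤ crossWeight (adjWeight G) A Aᶜ := by
    intro A hA hA'
    rw [crossWeight_adjWeight]
    exact h3ec A hA (by simpa using Finset.coe_nonempty.2 hA')
  have htriv : ∀ A : Finset V, 1 < A.card → 1 < Aᶜ.card →
      crossWeight (adjWeight G) A Aᶜ = 3 → (x ∈ A ↔ y ∈ A) := by
    intro A h1 h2 h3
    by_contra hne
    refine hnc A ⟨fun h => ?_, fun h => ?_⟩ (by rw [← crossWeight_adjWeight, h3]) ⟨he, ?_⟩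
    · exact absurd (card_le_one_of_isAcyclic hcubic h h3) (by omega)
    · rw [← Finset.coe_compl] at h
      exact absurd (card_le_one_of_isAcyclic hcubic h
        (by rw [compl_compl, crossWeight_comm adjWeight_comm, h3])) (by omega)
    · by_cases hx : x ∈ A
      · exact ⟨x, y, rfl, hx, fun h => hne (by simp_all)⟩
      · exact ⟨y, x, Sym2.eq_swap, by simp_all, hx⟩
  have hconn := connected_deleteEdges h3ec {s(x, y)} (Set.finite_singleton _) (by simp)
  obtain ⟨f, hf, hfno⟩ : ∃ f ∈ (G.deleteEdges {s(x, y)}).edgeSet,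
      ¬∃ M, IsPM (G.deleteEdges {s(x, y)}) M ∧ f ∈ M := by
    by_contra! h
    exact hnmc ⟨hconn, h⟩
  induction f with | h u v => ?_
  have huv : (G.deleteEdges {s(x, y)}).Adj u v := hf
  have hno : ¬∃ Q ≤ G.deleteEdges {s(x, y)}, Q.Adj u v ∧ ∀ v, ∃! w, Q.Adj v w :=
    fun ⟨Q, hQ, hQuv, hQM⟩ => hfno ⟨Q.edgeSet, isPM_edgeSet hQ hQM, hQuv⟩
  obtain ⟨ι, _, C, U, hC, hu, hv, hcard, hx, hy, hcover, hC3, hUU⟩ :=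
    exists_barrier hcubic hcut hxy htriv huv hno
  have hCU : ∀ {z}, (∃ i, C i = {z}) → z ∉ U := fun ⟨i, hi⟩ =>
    Finset.disjoint_left.1 (hC.disjoint_right i) (hi ▸ Finset.mem_singleton_self _)
  refine ⟨s(u, v), deleteEdges_le _ huv, ?_,
    connected_deleteEdges h3ec _ (Set.toFinite _) ((Set.ncard_insert_le _ _).trans (by simp)), ?_⟩
  · intro z hz hz'
    have hzU : z ∈ U := by rcases Sym2.mem_iff.1 hz' with rfl | rfl <;> assumption
    rcases Sym2.mem_iff.1 hz with rfl | rfl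
    · exact hCU hx hzU
    · exact hCU hy hzU
  · intro h hh
    induction h with | h a b => ?_
    obtain ⟨habG, hab⟩ := deleteEdges_adj.1 hh
    simp only [Set.mem_insert_iff, Set.mem_singleton_iff, not_or] at hab
    have habK : (G.deleteEdges {s(x, y)}).Adj a b := deleteEdges_adj.2 ⟨habG, hab.1⟩
    obtain ⟨P, hPK, hPab, hPM⟩ :
        ∃ P ≤ G.deleteEdges {s(x, y)}, P.Adj a b ∧ ∀ v, ∃! w, P.Adj v w := by
      by_cases ha : a ∈ U
      · have hb : b ∉ U := fun hb => hab.2 (hUU a ha b hb habK)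
        obtain ⟨i, hi⟩ := hcover b hb
        obtain ⟨P, hPK, hPab, hPM⟩ := exists_perfectMatching_of_mem_component hcubic hcut hxy hC
          hcard hx hy hcover hC3 hi habK.symm
        exact ⟨P, hPK, hPab.symm, hPM⟩
      · obtain ⟨i, hi⟩ := hcover a ha
        exact exists_perfectMatching_of_mem_component hcubic hcut hxy hC hcard hx hy hcover hC3
          hi habK
    refine ⟨P.edgeSet, isPM_edgeSet (fun p q hpq => ?_) hPM, hPab⟩
    obtain ⟨hpqG, hpq'⟩ := deleteEdges_adj.1 (hPK hpq)
    refine deleteEdges_adj.2 ⟨hpqG, ?_⟩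
    rintro (h | h)
    · exact hpq' h
    · refine hno ⟨P, hPK, ?_, hPM⟩
      rwa [← mem_edgeSet, ← Set.mem_singleton_iff.1 h]
end

section
/- Let G be a cyclically 4-edge-connected cubic graph and E(A,B) a cyclic 4-edge-cut with cut edges e₁,...,e₄ and end-vertices v₁,...,v₄ in A. For i,j denote by g_{ij} the number of matchings of G[A] covering all vertices of A except v_i and v_j. If one of g₂₃, g₂₄, g₃₄ is zero, say g_{ij} = 0, then either the other two are each at least two, or one of them equals one, say g_{ik} = 1, and G[A] is a ladder with ends v₁v_i and v_jv_k. -/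
open SimpleGraph
open scoped Classical

universe u

variable {V : Type u}

/-- The number of neighbours of `x` in `Y`. -/
noncomputable def nbCount (G : SimpleGraph V) (x : V) (Y : Finset V) : ℕ :=
  (Y.filter (G.Adj x)).card

/-- The number of adjacent pairs in `X × Y`. -/
noncomputable def crossCount (G : SimpleGraph V) (X Y : Finset V) : ℕ :=
  ∑ x ∈ X, nbCount G x Y

section Counting

variable {G : SimpleGraph V}

lemma nbCount_union {Y Z : Finset V} (h : Disjoint Y Z) (x : V) :
    nbCount G x (Y ∪ Z) = nbCount G x Y + nbCount G x Z := by
  unfold nbCount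
  rw [Finset.filter_union, Finset.card_union_of_disjoint]
  exact Finset.disjoint_filter_filter h

lemma nbCount_mono {Y Z : Finset V} (h : Y ⊆ Z) (x : V) : nbCount G x Y ≤ nbCount G x Z :=
  Finset.card_le_card (Finset.filter_subset_filter _ h)

lemma nbCount_eq_zero {Y : Finset V} {x : V} :
    nbCount G x Y = 0 ↔ ∀ y ∈ Y, ¬G.Adj x y := by
  simp [nbCount, Finset.filter_eq_empty_iff]

lemma nbCount_singleton (x y : V) : nbCount G x {y} = if G.Adj x y then 1 else 0 := by
  simp only [nbCount, Finset.filter_singleton]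
  split_ifs <;> simp

lemma nbCount_insert {Y : Finset V} {y : V} (h : y ∉ Y) (x : V) :
    nbCount G x (insert y Y) = (if G.Adj x y then 1 else 0) + nbCount G x Y := by
  rw [Finset.insert_eq, nbCount_union (by simpa using h), nbCount_singleton]

lemma nbCount_univ [Fintype V] (hc : CubicGraph G) (x : V) : nbCount G x Finset.univ = 3 := by
  rw [← hc x, Set.ncard_eq_toFinset_card', nbCount]
  congr 1
  ext y
  simp

lemma nbCount_add_compl [Fintype V] (hc : CubicGraph G) (x : V) (Y : Finset V) :
    nbCount G x Y + nbCount G x Yᶜ = 3 := by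
  rw [← nbCount_union disjoint_compl_right, Finset.union_compl, nbCount_univ hc]

lemma nbCount_le_three [Fintype V] (hc : CubicGraph G) (x : V) (Y : Finset V) :
    nbCount G x Y ≤ 3 := by
  have := nbCount_add_compl hc x Y
  omega

lemma crossCount_comm (X Y : Finset V) : crossCount G X Y = crossCount G Y X := by
  have := Finset.sum_card_bipartiteAbove_eq_sum_card_bipartiteBelow (s := X) (t := Y) G.Adj
  simpa [crossCount, nbCount, Finset.bipartiteAbove, Finset.bipartiteBelow, G.adj_comm] using this

lemma crossCount_union_right {Y Z : Finset V} (h : Disjoint Y Z) (X : Finset V) :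
    crossCount G X (Y ∪ Z) = crossCount G X Y + crossCount G X Z := by
  simp [crossCount, nbCount_union h, Finset.sum_add_distrib]

lemma crossCount_eq_zero {X Y : Finset V} :
    crossCount G X Y = 0 ↔ ∀ x ∈ X, ∀ y ∈ Y, ¬G.Adj x y := by
  simp [crossCount, nbCount_eq_zero]

lemma crossCount_self_add_compl [Fintype V] (hc : CubicGraph G) (X : Finset V) :
    crossCount G X X + crossCount G X Xᶜ = 3 * X.card := by
  rw [crossCount, crossCount, ← Finset.sum_add_distrib,
    Finset.sum_congr rfl fun x _ => nbCount_add_compl hc x X]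
  simp [mul_comm]

lemma crossCount_self [Fintype V] (X : Finset V) :
    crossCount G X X = 2 * (G.induce (X : Set V)).edgeFinset.card := by
  rw [← sum_degrees_eq_twice_card_edges, crossCount, ← Finset.sum_coe_sort]
  refine Finset.sum_congr rfl fun v _ => ?_
  rw [nbCount, ← card_neighborFinset_eq_degree,
    ← Finset.card_map ⟨Subtype.val, Subtype.val_injective⟩]
  congr 1
  ext y
  simp [and_comm]

lemma IsAcyclic.card_edgeFinset_lt {W : Type*} [Fintype W] [Nonempty W] {H : SimpleGraph W}
    [Fintype H.edgeSet] (h : H.IsAcyclic) : H.edgeFinset.card < Fintype.card W := by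
  obtain ⟨F, hHF, -, hF⟩ := (connected_top (V := W)).exists_isTree_le_of_le_of_isAcyclic le_top h
  have h1 := hF.card_edgeFinset
  have h2 := Finset.card_le_card (edgeFinset_mono hHF)
  omega

lemma card_add_two_le_of_isAcyclic [Fintype V] (hc : CubicGraph G) {X : Finset V}
    (hX : X.Nonempty) (h : (G.induce (X : Set V)).IsAcyclic) :
    X.card + 2 ≤ crossCount G X Xᶜ := by
  have : Nonempty (X : Set V) := hX.to_subtype
  have h1 := IsAcyclic.card_edgeFinset_lt h
  have h4 : Fintype.card (X : Set V) = X.card := by simp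
  have h2 := crossCount_self (G := G) X
  have h3 := crossCount_self_add_compl hc X
  omega

lemma crossCount_compl_mod_two [Fintype V] (hc : CubicGraph G) (X : Finset V) :
    crossCount G X Xᶜ % 2 = X.card % 2 := by
  have h2 := crossCount_self (G := G) X
  have h3 := crossCount_self_add_compl hc X
  omega

lemma ncard_cutEdges [Fintype V] (X : Finset V) :
    (cutEdges G (X : Set V)).ncard = crossCount G X Xᶜ := by
  rw [crossCount]
  unfold nbCount
  rw [← Finset.card_sigma, ← Set.ncard_coe_finset]
  symm
  refine Set.ncard_congr (fun a _ => s(a.1, a.2)) ?_ ?_ ?_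
  · rintro ⟨a, b⟩ h
    simp at h
    exact ⟨h.2.2, a, b, rfl, by simpa using h.1, by simpa using h.2.1⟩
  · rintro ⟨a, b⟩ ⟨c, d⟩ h h' e
    simp at h h' e
    grind
  · rintro e ⟨he, x, y, rfl, hx, hy⟩
    exact ⟨⟨x, y⟩, by simpa using ⟨by simpa using hx, by simpa using hy, he⟩, rfl⟩

end Counting

/-- Every nonempty subset of `A` is joined to its complement by at least four edges, or by at least
as many edges as a forest on the same number of vertices of degree three. -/
def HasLargeCuts [Fintype V] (G : SimpleGraph V) (A : Finset V) : Prop :=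
  ∀ X ⊆ A, X.Nonempty → 4 ≤ crossCount G X Xᶜ ∨ X.card + 2 ≤ crossCount G X Xᶜ

lemma isNearPM_of_sdiff {G : SimpleGraph V} {A X : Set V} {M : Set (Sym2 V)}
    (h : IsNearPM G (A \ X) ∅ M) : IsNearPM G A X M := by
  obtain ⟨h1, h2, -⟩ := h
  refine ⟨fun e he => ?_, by simpa using h2, fun w hw e he hwe => ?_⟩
  · obtain ⟨x, y, rfl, hxy, hx, hy⟩ := h1 e he
    exact ⟨x, y, rfl, hxy, hx.1, hy.1⟩
  · obtain ⟨x, y, rfl, hxy, hx, hy⟩ := h1 e he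
    rcases Sym2.mem_iff.1 hwe with rfl | rfl
    exacts [hx.2 hw, hy.2 hw]

lemma exists_isNearPM_of_isPerfectMatching {G : SimpleGraph V} {W : Set V}
    {M : (G.induce W).Subgraph} (hM : M.IsPerfectMatching) :
    ∃ N, IsNearPM G W ∅ N := by
  rw [Subgraph.isPerfectMatching_iff] at hM
  refine ⟨{e | ∃ x y : W, e = s(x.1, y.1) ∧ M.Adj x y}, ?_, ?_, by simp⟩
  · rintro e ⟨x, y, rfl, h⟩
    exact ⟨x, y, rfl, h.adj_sub, x.2, y.2⟩
  · rintro w ⟨hw, -⟩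
    obtain ⟨z, hz, huniq⟩ := hM ⟨w, hw⟩
    refine ⟨s(w, z.1), ⟨⟨⟨w, hw⟩, z, rfl, hz⟩, by simp⟩, ?_⟩
    rintro e ⟨⟨x, y, rfl, h⟩, hwe⟩
    rcases Sym2.mem_iff.1 hwe with rfl | rfl
    · rw [huniq y h]
    · rw [huniq x h.symm, Sym2.eq_swap]

lemma exists_isNearPM_or_barrier [Fintype V] (G : SimpleGraph V) {W : Finset V}
    (hW : Even W.card) :
    (∃ N, IsNearPM G W ∅ N) ∨
    ∃ (S : Finset V) (𝒞 : Finset (Finset V)), S ⊆ W ∧ S.card + 2 ≤ 𝒞.card ∧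
      (∀ C ∈ 𝒞, C ⊆ W \ S ∧ Odd C.card ∧
        ∀ x ∈ C, ∀ y ∈ W, y ∉ S → G.Adj x y → y ∈ C) ∧
      (𝒞 : Set (Finset V)).PairwiseDisjoint id := by
  by_cases h : ∃ M : (G.induce (W : Set V)).Subgraph, M.IsPerfectMatching
  · obtain ⟨M, hM⟩ := h
    exact .inl (exists_isNearPM_of_isPerfectMatching hM)
  right
  rw [tutte] at h
  push Not at h
  obtain ⟨u, hu⟩ := h
  rw [IsTutteViolator] at hu
  set D := (⊤ : (G.induce (W : Set V)).Subgraph).deleteVerts u with hD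
  have hpar := odd_ncard_oddComponents D.coe
  have hcard : Nat.card D.verts + u.ncard = W.card := by
    have h1 : D.verts = uᶜ := by simp [hD, Set.compl_eq_univ_sdiff]
    rw [h1, Nat.card_coe_set_eq, add_comm, Set.ncard_add_ncard_compl]
    simp
  have hge : u.ncard + 2 ≤ D.coe.oddComponents.ncard := by grind
  let ι : D.verts → V := fun z => z.1.1
  have hι : Function.Injective ι := Subtype.val_injective.comp Subtype.val_injective
  have hιmem (z : D.verts) : ι z ∈ W := z.1.2
  have hιu (z : D.verts) : z.1 ∉ u := by
    have := z.2
    simp only [hD, Subgraph.deleteVerts_verts] at this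
    exact this.2
  let f : D.coe.ConnectedComponent → Finset V := fun c => (ι '' c.supp).toFinset
  have hfmem (c) (x) : x ∈ f c ↔ ∃ z, D.coe.connectedComponentMk z = c ∧ ι z = x := by
    simp [f]
  have hdisj (c c') (x : V) (h1 : x ∈ f c) (h2 : x ∈ f c') : c = c' := by
    rw [hfmem] at h1 h2
    obtain ⟨z, rfl, rfl⟩ := h1
    obtain ⟨z', rfl, e⟩ := h2
    rw [hι e]
  have hne (c) : (f c).Nonempty := by
    obtain ⟨z, rfl⟩ := c.exists_rep
    exact ⟨ι z, (hfmem _ _).2 ⟨z, rfl, rfl⟩⟩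
  have hfinj : Function.Injective f := by
    intro c c' e
    obtain ⟨x, hx⟩ := hne c
    exact hdisj c c' x hx (e ▸ hx)
  have hfcard (c) : (f c).card = c.supp.ncard := by
    rw [← Set.ncard_eq_toFinset_card', Set.ncard_image_of_injective _ hι]
  refine ⟨(Subtype.val '' u).toFinset, D.coe.oddComponents.toFinset.image f, ?_, ?_, ?_, ?_⟩
  · intro x hx
    simp only [Set.mem_toFinset, Set.mem_image] at hx
    obtain ⟨z, -, rfl⟩ := hx
    exact z.2
  · rw [Finset.card_image_of_injective _ hfinj, ← Set.ncard_eq_toFinset_card',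
      ← Set.ncard_eq_toFinset_card', Set.ncard_image_of_injective _ Subtype.val_injective]
    exact hge
  · intro C hC
    simp only [Finset.mem_image, Set.mem_toFinset] at hC
    obtain ⟨c, hc, rfl⟩ := hC
    refine ⟨fun x hx => ?_, by rw [hfcard]; exact hc, fun x hx y hy hyS hxy => ?_⟩
    · obtain ⟨z, -, rfl⟩ := (hfmem _ _).1 hx
      simp only [Finset.mem_sdiff, hιmem, Set.mem_toFinset, Set.mem_image, true_and]
      rintro ⟨t, ht, e⟩
      exact hιu z ((Subtype.val_injective e : t = z.1) ▸ ht)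
    · obtain ⟨z, rfl, rfl⟩ := (hfmem _ _).1 hx
      have hyu : (⟨y, hy⟩ : (W : Set V)) ∉ u := by
        intro h
        apply hyS
        simp only [Set.mem_toFinset, Set.mem_image]
        exact ⟨_, h, rfl⟩
      have hyD : (⟨y, hy⟩ : (W : Set V)) ∈ D.verts := by simp [hD, hyu]
      refine (hfmem _ _).2 ⟨⟨⟨y, hy⟩, hyD⟩, ?_, rfl⟩
      apply ConnectedComponent.sound
      apply Adj.reachable
      simp only [Subgraph.coe_adj, hD, Subgraph.deleteVerts_adj, Subgraph.verts_top,
        Set.mem_univ, true_and, Subgraph.top_adj, comap_adj]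
      exact ⟨hyu, hιu z, hxy.symm⟩
  · intro C hC C' hC' hCC'
    simp only [Finset.coe_image, Set.mem_image] at hC hC'
    obtain ⟨c, -, rfl⟩ := hC
    obtain ⟨c', -, rfl⟩ := hC'
    rw [Function.onFun, Finset.disjoint_left]
    intro x hx hx'
    exact hCC' (by rw [hdisj c c' x hx hx'])

/-- The edges leaving `A` are incident with four distinct vertices `a`, `b`, `c`, `d` of `A`,
one edge with each of them. -/
structure FourEnds [Fintype V] (G : SimpleGraph V) (A : Finset V) (a b c d : V) : Prop where
  mem : a ∈ A ∧ b ∈ A ∧ c ∈ A ∧ d ∈ A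
  ne : a ≠ b ∧ a ≠ c ∧ a ≠ d ∧ b ≠ c ∧ b ≠ d ∧ c ≠ d
  out : ∀ x ∈ A, nbCount G x Aᶜ = if x = a ∨ x = b ∨ x = c ∨ x = d then 1 else 0

/-- Every edge of `G[A]` joins a vertex of `I ⊆ A` to a vertex of `A \ I`. -/
def IsBipartition (G : SimpleGraph V) (A I : Finset V) : Prop :=
  I ⊆ A ∧ ∀ x ∈ A, ∀ y ∈ A, G.Adj x y → (x ∈ I ↔ y ∉ I)

section Bipartition

variable [Fintype V] {G : SimpleGraph V} {A : Finset V} {a b c d : V}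

lemma FourEnds.crossCount_compl (h : FourEnds G A a b c d) {X : Finset V} (hX : X ⊆ A) :
    crossCount G X Aᶜ = (X.filter fun x => x = a ∨ x = b ∨ x = c ∨ x = d).card := by
  rw [crossCount, Finset.sum_congr rfl fun x hx => h.out x (hX hx), Finset.sum_boole]
  simp

lemma FourEnds.even_card (hc : CubicGraph G) (h : FourEnds G A a b c d) : Even A.card := by
  have h1 := h.crossCount_compl subset_rfl
  have h2 : (A.filter fun x => x = a ∨ x = b ∨ x = c ∨ x = d) = {a, b, c, d} := by
    ext x
    have := h.mem
    simp only [Finset.mem_filter, Finset.mem_insert, Finset.mem_singleton]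
    grind
  have h3 : ({a, b, c, d} : Finset V).card = 4 := by
    have := h.ne
    grind
  rw [h2, h3] at h1
  have := crossCount_compl_mod_two hc A
  rw [Nat.even_iff]
  omega

lemma exists_isBipartition (hc : CubicGraph G) (hK : HasLargeCuts G A)
    (h : FourEnds G A a b c d) (hno : ¬∃ M, IsNearPM G A {c, d} M) :
    ∃ I, IsBipartition G A I ∧ a ∈ I ∧ b ∈ I ∧ c ∉ I ∧ d ∉ I := by
  obtain ⟨haA, hbA, hcA, hdA⟩ := h.mem
  obtain ⟨hab, hac, had, hbc, hbd, hcd⟩ := h.ne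
  have hcdA : ({c, d} : Finset V) ⊆ A := by simp [Finset.insert_subset_iff, hcA, hdA]
  set W := A \ {c, d} with hWdef
  have hWcard : W.card + 2 = A.card := by
    rw [hWdef, ← Finset.card_pair hcd, Finset.card_sdiff_add_card_eq_card hcdA]
  have hWeven : Even W.card := by
    have := h.even_card hc
    grind
  rcases exists_isNearPM_or_barrier G hWeven with ⟨N, hN⟩ | ⟨S, 𝒞, hSW, hcard, h𝒞, hdisj⟩
  · exact (hno ⟨N, isNearPM_of_sdiff (by simpa [hWdef] using hN)⟩).elim
  set U := 𝒞.biUnion id with hU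
  have hUmem (x) : x ∈ U ↔ ∃ C ∈ 𝒞, x ∈ C := by simp [hU]
  clear_value U W
  have hUWS : U ⊆ W \ S := by
    intro x hx
    obtain ⟨C, hC, hxC⟩ := (hUmem x).1 hx
    exact (h𝒞 C hC).1 hxC
  have hWA : W ⊆ A := hWdef ▸ Finset.sdiff_subset
  have hUA : U ⊆ A := hUWS.trans (Finset.sdiff_subset.trans hWA)
  have hsub {C} (hC : C ∈ 𝒞) : C ⊆ U := fun x hx => (hUmem x).2 ⟨C, hC, hx⟩
  have hbd_ge : ∀ C ∈ 𝒞, 3 ≤ crossCount G C Cᶜ ∧ (crossCount G C Cᶜ = 3 → C.card ≤ 1) := by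
    intro C hC
    have hodd := (h𝒞 C hC).2.1
    have := hK C ((hsub hC).trans hUA) (Finset.card_pos.1 hodd.pos)
    have := hodd.pos
    omega
  have hbd_eq : ∀ C ∈ 𝒞, crossCount G C Cᶜ = ∑ x ∈ C, nbCount G x Uᶜ := by
    intro C hC
    refine Finset.sum_congr rfl fun x hx => ?_
    have e : Cᶜ = Uᶜ ∪ U \ C := by
      ext y
      have := @hsub C hC y
      simp only [Finset.mem_compl, Finset.mem_union, Finset.mem_sdiff]
      tauto
    have hd : Disjoint Uᶜ (U \ C) :=
      disjoint_compl_left.mono_right Finset.sdiff_subset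
    have h0 : nbCount G x (U \ C) = 0 := by
      rw [nbCount_eq_zero]
      intro y hy hxy
      rw [Finset.mem_sdiff] at hy
      have := Finset.mem_sdiff.1 (hUWS hy.1)
      exact hy.2 ((h𝒞 C hC).2.2 x hx y this.1 this.2 hxy)
    rw [e, nbCount_union hd, h0, add_zero]
  have hsum : ∑ C ∈ 𝒞, crossCount G C Cᶜ = crossCount G U Uᶜ := by
    rw [Finset.sum_congr rfl hbd_eq, crossCount, hU, Finset.sum_biUnion hdisj]
    rfl
  have hlow : 3 * 𝒞.card ≤ crossCount G U Uᶜ := by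
    rw [← hsum, mul_comm, ← smul_eq_mul]
    exact Finset.card_nsmul_le_sum _ _ _ fun C hC => (hbd_ge C hC).1
  have hsplit : crossCount G U Uᶜ
      = crossCount G S U + (nbCount G c U + nbCount G d U) + crossCount G U Aᶜ := by
    have e : Uᶜ = ((S ∪ {c, d}) ∪ Aᶜ) ∪ (W \ S) \ U := by
      ext y
      have h1 := @hUWS y
      have h2 := @hSW y
      have h3 := @hcdA y
      simp only [Finset.mem_compl, Finset.mem_union, Finset.mem_sdiff, hWdef] at *
      tauto
    have d1 : Disjoint ((S ∪ {c, d}) ∪ Aᶜ) ((W \ S) \ U) := by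
      rw [Finset.disjoint_left]
      intro y
      simp only [Finset.mem_compl, Finset.mem_union, Finset.mem_sdiff, hWdef]
      tauto
    have d2 : Disjoint (S ∪ {c, d}) Aᶜ :=
      disjoint_compl_right.mono_left (Finset.union_subset (hSW.trans hWA) hcdA)
    have d3 : Disjoint S {c, d} := by
      rw [hWdef] at hSW
      exact Finset.sdiff_disjoint.mono_left hSW
    have h0 : crossCount G U ((W \ S) \ U) = 0 := by
      rw [crossCount_eq_zero]
      intro x hx y hy hxy
      obtain ⟨C, hC, hxC⟩ := (hUmem x).1 hx
      simp only [Finset.mem_sdiff] at hy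
      exact hy.2 (hsub hC ((h𝒞 C hC).2.2 x hxC y hy.1.1 hy.1.2 hxy))
    rw [e, crossCount_union_right d1, crossCount_union_right d2, crossCount_union_right d3, h0,
      crossCount_comm U S, crossCount_comm U {c, d}]
    simp [crossCount, Finset.sum_pair hcd]
  have hSU : crossCount G S U ≤ 3 * S.card := by
    rw [mul_comm, ← smul_eq_mul]
    exact Finset.sum_le_card_nsmul _ _ _ fun x _ => nbCount_le_three hc x U
  have hend (z) (hz : z ∈ A) (hz' : z = a ∨ z = b ∨ z = c ∨ z = d) :
      nbCount G z U + nbCount G z (A \ U) = 2 := by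
    have h1 := h.out z hz
    rw [if_pos hz'] at h1
    have h2 := nbCount_add_compl hc z A
    rw [← Finset.union_sdiff_of_subset hUA, nbCount_union Finset.disjoint_sdiff,
      Finset.union_sdiff_of_subset hUA] at h2
    omega
  have hcU := hend c hcA (by simp)
  have hdU := hend d hdA (by simp)
  have hUout := h.crossCount_compl hUA
  have hfil : (U.filter fun x => x = a ∨ x = b ∨ x = c ∨ x = d) ⊆ {a, b} := by
    intro x hx
    simp only [Finset.mem_filter, Finset.mem_insert, Finset.mem_singleton] at hx ⊢
    have := hUWS hx.1
    simp only [hWdef, Finset.mem_sdiff, Finset.mem_insert, Finset.mem_singleton] at this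
    tauto
  have hfil_card := Finset.card_le_card hfil
  rw [Finset.card_pair hab] at hfil_card
  have hfil_eq := Finset.eq_of_subset_of_card_le hfil (by rw [Finset.card_pair hab]; omega)
  have haU : a ∈ U := by
    have : a ∈ ({a, b} : Finset V) := by simp
    rw [← hfil_eq] at this
    exact (Finset.mem_filter.1 this).1
  have hbU : b ∈ U := by
    have : b ∈ ({a, b} : Finset V) := by simp
    rw [← hfil_eq] at this
    exact (Finset.mem_filter.1 this).1
  have hSall : ∀ s ∈ S, nbCount G s (A \ U) = 0 := by
    have h1 : ∑ s ∈ S, nbCount G s U = ∑ s ∈ S, 3 := by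
      rw [Finset.sum_const, smul_eq_mul]
      change crossCount G S U = _
      omega
    have h2 := (Finset.sum_eq_sum_iff_of_le fun s _ => nbCount_le_three hc s U).1 h1
    intro s hs
    have h3 := nbCount_add_compl hc s U
    have h4 : nbCount G s (A \ U) ≤ nbCount G s Uᶜ :=
      nbCount_mono (by intro y; simp) s
    have := h2 s hs
    omega
  have hCall : ∀ C ∈ 𝒞, C.card ≤ 1 := by
    have h1 : ∑ C ∈ 𝒞, 3 = ∑ C ∈ 𝒞, crossCount G C Cᶜ := by
      rw [hsum, Finset.sum_const, smul_eq_mul]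
      omega
    have h2 := (Finset.sum_eq_sum_iff_of_le fun C hC => (hbd_ge C hC).1).1 h1
    exact fun C hC => (hbd_ge C hC).2 (h2 C hC).symm
  have hUindep : ∀ x ∈ U, ∀ y ∈ U, ¬G.Adj x y := by
    intro x hx y hy hxy
    obtain ⟨C, hC, hxC⟩ := (hUmem x).1 hx
    have := Finset.mem_sdiff.1 (hUWS hy)
    have hyC := (h𝒞 C hC).2.2 x hxC y this.1 this.2 hxy
    exact hxy.ne (Finset.card_le_one.1 (hCall C hC) x hxC y hyC)
  have hT : ∀ x ∈ S ∪ {c, d}, nbCount G x (A \ U) = 0 := by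
    intro x hx
    simp only [Finset.mem_union, Finset.mem_insert, Finset.mem_singleton] at hx
    rcases hx with hx | rfl | rfl
    · exact hSall x hx
    · omega
    · omega
  have hR : A \ U ⊆ S ∪ {c, d} := by
    by_contra hne
    have hne' : ((A \ U) \ (S ∪ {c, d})).Nonempty := by
      rwa [Finset.nonempty_iff_ne_empty, Ne, Finset.sdiff_eq_empty_iff_subset]
    have h1 := hK _ (Finset.sdiff_subset.trans Finset.sdiff_subset) hne'
    have h0 : crossCount G ((A \ U) \ (S ∪ {c, d})) ((A \ U) \ (S ∪ {c, d}))ᶜ = 0 := by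
      rw [crossCount_eq_zero]
      intro x hx y hy hxy
      have hx' := hx
      simp only [Finset.mem_sdiff] at hx'
      obtain ⟨⟨hxA, hxU⟩, hxT⟩ := hx'
      by_cases hyA : y ∈ A
      · by_cases hyU : y ∈ U
        · obtain ⟨C, hC, hyC⟩ := (hUmem y).1 hyU
          refine hxU (hsub hC ((h𝒞 C hC).2.2 y hyC x ?_ ?_ hxy.symm)) <;>
            simp only [hWdef, Finset.mem_sdiff, Finset.mem_union] at * <;> tauto
        · have hyT : y ∈ S ∪ {c, d} := by
            by_contra hyT
            exact Finset.mem_compl.1 hy (by simp only [Finset.mem_sdiff]; tauto)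
          exact nbCount_eq_zero.1 (hT y hyT) x (by simp [hxA, hxU]) hxy.symm
      · have h2 := h.out x hxA
        rw [if_neg] at h2
        · exact nbCount_eq_zero.1 h2 y (by simpa using hyA) hxy
        · rintro (rfl | rfl | rfl | rfl)
          · exact hxU haU
          · exact hxU hbU
          · simp at hxT
          · simp at hxT
    omega
  have hnot : ∀ z ∈ S ∪ {c, d}, z ∉ U := by
    intro z hz hzU
    have := hUWS hzU
    simp only [hWdef, Finset.mem_sdiff, Finset.mem_union] at *
    tauto
  refine ⟨U, ⟨hUA, fun x hx y hy hxy => ⟨fun hxU hyU => hUindep x hxU y hyU hxy, fun hyU => ?_⟩⟩,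
    haU, hbU, hnot c (by simp), hnot d (by simp)⟩
  by_contra hxU
  exact nbCount_eq_zero.1 (hT x (hR (by simp [hx, hxU]))) y (by simp [hy, hyU]) hxy

lemma exists_isNearPM_of_isBipartition (hc : CubicGraph G) (hK : HasLargeCuts G A)
    (h : FourEnds G A a b c d) {I : Finset V} (hI : IsBipartition G A I)
    (ha : a ∈ I) (hb : b ∈ I) (hcI : c ∉ I) (hdI : d ∉ I) :
    ∃ M, IsNearPM G A {d, b} M := by
  obtain ⟨haA, hbA, hcA, hdA⟩ := h.mem
  obtain ⟨hab, hac, had, hbc, hbd, hcd⟩ := h.ne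
  by_contra hno
  have h' : FourEnds G A a c d b :=
    ⟨⟨haA, hcA, hdA, hbA⟩, ⟨hac, had, hab, hcd, hbc.symm, hbd.symm⟩, fun x hx => by
      rw [h.out x hx]; congr 1; grind⟩
  obtain ⟨J, hJ, haJ, hcJ, hdJ, hbJ⟩ := exists_isBipartition hc hK h' hno
  set X := A.filter fun x => x ∈ I ↔ x ∈ J with hX
  have hXA : X ⊆ A := Finset.filter_subset _ _
  have h1 := hK X hXA ⟨a, by simp [hX, haA, ha, haJ]⟩
  have haX : 0 < X.card := Finset.card_pos.2 ⟨a, by simp [hX, haA, ha, haJ]⟩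
  have h0 : crossCount G X (A \ X) = 0 := by
    rw [crossCount_eq_zero]
    intro x hx y hy hxy
    simp only [hX, Finset.mem_filter, Finset.mem_sdiff] at hx hy
    have := hI.2 x hx.1 y hy.1 hxy
    have := hJ.2 x hx.1 y hy.1 hxy
    tauto
  have e : Xᶜ = Aᶜ ∪ A \ X := by
    ext y
    have := @hXA y
    simp only [Finset.mem_compl, Finset.mem_union, Finset.mem_sdiff]
    tauto
  have hd : Disjoint Aᶜ (A \ X) :=
    disjoint_compl_left.mono_right Finset.sdiff_subset
  rw [e, crossCount_union_right hd, h0, h.crossCount_compl hXA] at h1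
  have h2 : (X.filter fun x => x = a ∨ x = b ∨ x = c ∨ x = d) ⊆ {a, d} := by
    intro x hx
    simp only [Finset.mem_filter, Finset.mem_insert, Finset.mem_singleton, hX] at hx ⊢
    rcases hx with ⟨⟨-, hx⟩, rfl | rfl | rfl | rfl⟩ <;> tauto
  have h3 := Finset.card_le_card h2
  rw [Finset.card_pair had] at h3
  omega

end Bipartition

section Uniqueness

variable {G : SimpleGraph V}

lemma nbCount_erase {A : Finset V} {x y : V} (hy : y ∈ A) :
    nbCount G x A = (if G.Adj x y then 1 else 0) + nbCount G x (A.erase y) := by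
  rw [← nbCount_insert (Finset.notMem_erase y A), Finset.insert_erase hy]

lemma exists_other_neighbor {A : Finset V} {x y : V} (h : nbCount G x A = 2) (hy : y ∈ A)
    (hxy : G.Adj x y) :
    ∃ z ∈ A, z ≠ y ∧ ∀ w ∈ A, G.Adj x w ↔ w = y ∨ w = z := by
  have h1 := nbCount_erase (G := G) (x := x) hy
  rw [if_pos hxy] at h1
  obtain ⟨z, hz⟩ := Finset.card_eq_one.1 (show nbCount G x (A.erase y) = 1 by omega)
  have hmem (w) : (w ≠ y ∧ w ∈ A) ∧ G.Adj x w ↔ w = z := by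
    simpa using Finset.ext_iff.1 hz w
  have hzz := (hmem z).2 rfl
  refine ⟨z, hzz.1.2, hzz.1.1, fun w hw => ?_⟩
  have := hmem w
  by_cases hwy : w = y
  · simp [hwy, hxy]
  · tauto

lemma IsNearPM.exists_partner {A X : Set V} {M : Set (Sym2 V)} (h : IsNearPM G A X M) {x : V}
    (hx : x ∈ A \ X) :
    ∃ y, y ∈ A \ X ∧ G.Adj x y ∧ s(x, y) ∈ M ∧ ∀ e ∈ M, x ∈ e → e = s(x, y) := by
  obtain ⟨e, ⟨he, hxe⟩, huniq⟩ := h.2.1 x hx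
  obtain ⟨y, rfl⟩ := Sym2.mem_iff_exists.1 hxe
  obtain ⟨u, v, huv, hadj, hu, hv⟩ := h.1 _ he
  have hy : y ∈ A ∧ G.Adj x y := by
    rcases Sym2.eq_iff.1 huv with ⟨rfl, rfl⟩ | ⟨rfl, rfl⟩
    exacts [⟨hv, hadj⟩, ⟨hu, hadj.symm⟩]
  exact ⟨y, ⟨hy.1, fun hyX => h.2.2 y hyX _ he (by simp)⟩, hy.2, he,
    fun e' he' hxe' => huniq e' ⟨he', hxe'⟩⟩

lemma exists_subset_image_eq {α : Type*} {J : Finset α} (hJ : J.Nonempty)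
    {σ : α → α} (hσ : ∀ x ∈ J, σ x ∈ J) :
    ∃ Z ⊆ J, Z.Nonempty ∧ Z.image σ = Z := by
  obtain ⟨Z, hZJ, ⟨hne, hmaps⟩, hmin⟩ := exists_minimal_le_of_wellFoundedLT
    (fun Z : Finset α => Z.Nonempty ∧ ∀ x ∈ Z, σ x ∈ Z) J ⟨hJ, hσ⟩
  have hsub : Z.image σ ⊆ Z := Finset.image_subset_iff.2 hmaps
  refine ⟨Z, hZJ, hne, hsub.antisymm (hmin ⟨hne.image σ, ?_⟩ hsub)⟩
  intro x hx
  exact Finset.mem_image_of_mem σ (hsub hx)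

lemma exists_ne_isNearPM {A I : Finset V} {d b : V} {M : Set (Sym2 V)}
    (hI : IsBipartition G A I) (hd : d ∉ I) (hM : IsNearPM G A {d, b} M)
    (hne : (I.erase b).Nonempty)
    (hf : ∀ x ∈ I.erase b, ∃ y ∈ A, y ≠ d ∧ G.Adj x y ∧ s(x, y) ∉ M) (hb : b ∈ I) :
    ∃ M', IsNearPM G A {d, b} M' ∧ M' ≠ M := by
  have hpart : ∀ x, ∃ y, x ∈ (A : Set V) \ {d, b} →
      y ∈ (A : Set V) \ {d, b} ∧ G.Adj x y ∧ s(x, y) ∈ M ∧ ∀ e ∈ M, x ∈ e → e = s(x, y) := by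
    intro x
    by_cases hx : x ∈ (A : Set V) \ {d, b}
    · obtain ⟨y, hy⟩ := hM.exists_partner hx
      exact ⟨y, fun _ => hy⟩
    · exact ⟨x, fun h => (hx h).elim⟩
  choose p hp using hpart
  choose! f hfA hfd hfadj hfM using hf
  set W : Set V := (A : Set V) \ {d, b} with hW
  have hWmem (x) : x ∈ W ↔ x ∈ A ∧ x ≠ d ∧ x ≠ b := by simp [hW]
  have hpp {x} (hx : x ∈ W) : p (p x) = x := by
    have h1 := hp x hx
    have h2 := (hp (p x) h1.1).2.2.2 _ h1.2.2.1 (by simp)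
    rw [Sym2.eq_swap] at h2
    exact (Sym2.congr_right.1 h2).symm
  have hbip {x y} (hx : x ∈ A) (hy : y ∈ A) (hxy : G.Adj x y) := hI.2 x hx y hy hxy
  have hJW {x} (hx : x ∈ I.erase b) : x ∈ W := by
    rw [Finset.mem_erase] at hx
    exact (hWmem x).2 ⟨hI.1 hx.2, fun e => hd (e ▸ hx.2), hx.1⟩
  have hfI {x} (hx : x ∈ I.erase b) : f x ∉ I :=
    (hbip (hI.1 (Finset.mem_of_mem_erase hx)) (hfA x hx) (hfadj x hx)).1
      (Finset.mem_of_mem_erase hx)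
  have hfW {x} (hx : x ∈ I.erase b) : f x ∈ W :=
    (hWmem _).2 ⟨hfA x hx, hfd x hx, fun e => hfI hx (e ▸ hb)⟩
  have hpI {x} (hx : x ∈ W) : x ∈ I ↔ p x ∉ I :=
    hbip ((hWmem x).1 hx).1 ((hWmem _).1 (hp x hx).1).1 (hp x hx).2.1
  have hσ : ∀ x ∈ I.erase b, p (f x) ∈ I.erase b := by
    intro x hx
    have h1 := hfW hx
    rw [Finset.mem_erase]
    exact ⟨((hWmem _).1 (hp _ h1).1).2.2, by have := hpI h1; have := hfI hx; tauto⟩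
  obtain ⟨Z, hZJ, hZne, hZ⟩ := exists_subset_image_eq hne hσ
  have hZinj : Set.InjOn (fun x => p (f x)) Z := Finset.card_image_iff.1 (by rw [hZ])
  have hZI {z} (hz : z ∈ Z) : z ∈ I := Finset.mem_of_mem_erase (hZJ hz)
  refine ⟨{e | (e ∈ M ∧ ∀ z ∈ Z, z ∉ e) ∨ ∃ z ∈ Z, e = s(z, f z)}, ⟨?_, ?_, ?_⟩, ?_⟩
  · rintro e (⟨he, -⟩ | ⟨z, hz, rfl⟩)
    · exact hM.1 e he
    · exact ⟨z, f z, rfl, hfadj z (hZJ hz), hI.1 (hZI hz), hfA z (hZJ hz)⟩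
  · intro w hw
    obtain ⟨hpw, -, hpM, hpuniq⟩ := hp w hw
    by_cases hwI : w ∈ I
    · have hpwI := (hpI hw).1 hwI
      by_cases hwZ : w ∈ Z
      · refine ⟨s(w, f w), ⟨.inr ⟨w, hwZ, rfl⟩, by simp⟩, ?_⟩
        rintro e ⟨⟨-, he⟩ | ⟨z, hz, rfl⟩, hwe⟩
        · exact (he w hwZ hwe).elim
        · rcases Sym2.mem_iff.1 hwe with rfl | rfl
          · rfl
          · exact (hfI (hZJ hz) hwI).elim
      · refine ⟨s(w, p w), ⟨.inl ⟨hpM, ?_⟩, by simp⟩, ?_⟩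
        · intro z hz hze
          rcases Sym2.mem_iff.1 hze with rfl | rfl
          · exact hwZ hz
          · exact hpwI (hZI hz)
        · rintro e ⟨⟨he, -⟩ | ⟨z, hz, rfl⟩, hwe⟩
          · exact hpuniq e he hwe
          · rcases Sym2.mem_iff.1 hwe with rfl | rfl
            · exact (hwZ hz).elim
            · exact (hfI (hZJ hz) hwI).elim
    · by_cases hpZ : p w ∈ Z
      · have hpZ' := hpZ
        rw [← hZ, Finset.mem_image] at hpZ'
        obtain ⟨z, hz, hzw⟩ := hpZ'
        have hwz : f z = w := by rw [← hpp (hfW (hZJ hz)), hzw, hpp hw]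
        subst hwz
        refine ⟨s(z, f z), ⟨.inr ⟨z, hz, rfl⟩, by simp⟩, ?_⟩
        rintro e ⟨⟨he, heZ⟩ | ⟨z', hz', rfl⟩, hwe⟩
        · exact (heZ _ hpZ (hpuniq e he hwe ▸ by simp)).elim
        · rcases Sym2.mem_iff.1 hwe with h | h
          · exact (hwI (h ▸ hZI hz')).elim
          · rw [hZinj hz hz' (by simp [h])]
      · refine ⟨s(w, p w), ⟨.inl ⟨hpM, ?_⟩, by simp⟩, ?_⟩
        · intro z hz hze
          rcases Sym2.mem_iff.1 hze with rfl | rfl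
          · exact hwI (hZI hz)
          · exact hpZ hz
        · rintro e ⟨⟨he, -⟩ | ⟨z, hz, rfl⟩, hwe⟩
          · exact hpuniq e he hwe
          · rcases Sym2.mem_iff.1 hwe with rfl | rfl
            · exact (hwI (hZI hz)).elim
            · refine (hpZ ?_).elim
              rw [← hZ]
              exact Finset.mem_image_of_mem _ hz
  · rintro w hw e (⟨he, -⟩ | ⟨z, hz, rfl⟩) hwe
    · exact hM.2.2 w hw e he hwe
    · rcases Sym2.mem_iff.1 hwe with rfl | rfl
      · exact (hJW (hZJ hz)).2 hw
      · exact (hfW (hZJ hz)).2 hw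
  · intro e
    obtain ⟨z, hz⟩ := hZne
    apply hfM z (hZJ hz)
    rw [← e]
    exact .inr ⟨z, hz, rfl⟩

variable [Fintype V] {A I : Finset V} {a b c d : V}

lemma FourEnds.swap₁₂ (h : FourEnds G A a b c d) : FourEnds G A b a c d :=
  ⟨by have := h.mem; tauto, by have := h.ne; grind, fun x hx => by
    rw [h.out x hx]; congr 1; grind⟩

lemma FourEnds.swap₂₃ (h : FourEnds G A a b c d) : FourEnds G A a c b d :=
  ⟨by have := h.mem; tauto, by have := h.ne; grind, fun x hx => by
    rw [h.out x hx]; congr 1; grind⟩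

lemma FourEnds.swap₃₄ (h : FourEnds G A a b c d) : FourEnds G A a b d c :=
  ⟨by have := h.mem; tauto, by have := h.ne; grind, fun x hx => by
    rw [h.out x hx]; congr 1; grind⟩

lemma FourEnds.nbCount_eq_two (hc : CubicGraph G) (h : FourEnds G A a b c d) :
    nbCount G a A = 2 := by
  have h1 := h.out a h.mem.1
  rw [if_pos (by simp)] at h1
  have := nbCount_add_compl hc a A
  omega

lemma adj_of_isNearPM_unique (hc : CubicGraph G) (hK : HasLargeCuts G A)
    (h : FourEnds G A a b c d) (hI : IsBipartition G A I)
    (ha : a ∈ I) (hb : b ∈ I) (hcI : c ∉ I) (hdI : d ∉ I)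
    (huniq : ∀ M M', IsNearPM G A {d, b} M → IsNearPM G A {d, b} M' → M = M') :
    G.Adj a d := by
  by_contra had
  obtain ⟨M, hM⟩ := exists_isNearPM_of_isBipartition hc hK h hI ha hb hcI hdI
  obtain ⟨haA, hbA, hcA, hdA⟩ := h.mem
  have hne := h.ne
  obtain ⟨M', hM', hMM'⟩ := exists_ne_isNearPM hI hdI hM ⟨a, by simp [ha, hne.1]⟩ (fun x hx => by
    rw [Finset.mem_erase] at hx
    have hxA := hI.1 hx.2
    have hxd : x ≠ d := fun e => hdI (e ▸ hx.2)
    have hxc : x ≠ c := fun e => hcI (e ▸ hx.2)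
    obtain ⟨y, -, -, -, hy⟩ := hM.exists_partner (x := x) (by simp [hxA, hxd, hx.1])
    have h2 : 1 < nbCount G x (A.erase d) := by
      have h1 := nbCount_erase (G := G) (x := x) hdA
      by_cases hxa : x = a
      · subst hxa
        rw [if_neg had, h.nbCount_eq_two hc] at h1
        omega
      · have h3 := h.out x hxA
        rw [if_neg (by tauto)] at h3
        have := nbCount_add_compl hc x A
        split_ifs at h1 <;> omega
    obtain ⟨z, hz, hzy⟩ := Finset.exists_mem_ne h2 y
    simp only [Finset.mem_filter, Finset.mem_erase] at hz
    exact ⟨z, hz.1.2, hz.1.1, hz.2, fun hzM => hzy (Sym2.congr_right.1 (hy _ hzM (by simp)))⟩) hb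
  exact hMM' (huniq _ _ hM' hM)

lemma FourEnds.eq_of_adj_of_adj (hc : CubicGraph G) (hK : HasLargeCuts G A)
    (h : FourEnds G A a b c d) (hab : G.Adj b a) (hcb : G.Adj b c) :
    A = {a, b, c, d} := by
  obtain ⟨haA, hbA, hcA, hdA⟩ := h.mem
  obtain ⟨nab, nac, nad, nbc, nbd, ncd⟩ := h.ne
  set X := A \ {a, b, c} with hX
  have hdX : d ∈ X := by simp [hX, hdA, nad.symm, nbd.symm, ncd.symm]
  have hXA : X ⊆ A := Finset.sdiff_subset
  have e : Xᶜ = Aᶜ ∪ {a, b, c} := by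
    ext y
    simp only [hX, Finset.mem_compl, Finset.mem_union, Finset.mem_sdiff]
    tauto
  have hd1 : Disjoint Aᶜ {a, b, c} := by
    simp [haA, hbA, hcA]
  have hsum : crossCount G X {a, b, c} = nbCount G a X + (nbCount G b X + nbCount G c X) := by
    rw [crossCount_comm, crossCount, Finset.sum_insert (by simp [nab, nac]), Finset.sum_pair nbc]
  have h1 := hK X hXA ⟨d, hdX⟩
  rw [e, crossCount_union_right hd1, h.crossCount_compl hXA, hsum] at h1
  have h2 : (X.filter fun x => x = a ∨ x = b ∨ x = c ∨ x = d) ⊆ {d} := by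
    intro x
    simp only [hX, Finset.mem_filter, Finset.mem_sdiff, Finset.mem_insert, Finset.mem_singleton]
    tauto
  have h3 := Finset.card_le_card h2
  rw [Finset.card_singleton] at h3
  have hXe (z) (hz : z = a ∨ z = b ∨ z = c) : X ⊆ A.erase z := by
    intro x
    simp only [hX, Finset.mem_sdiff, Finset.mem_insert, Finset.mem_singleton, Finset.mem_erase]
    grind
  have ha2 := nbCount_erase (G := G) (x := a) hbA
  rw [h.nbCount_eq_two hc, if_pos hab.symm] at ha2
  have ha3 := nbCount_mono (G := G) (hXe b (by simp)) a
  have hc2 := nbCount_erase (G := G) (x := c) hbA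
  rw [h.swap₂₃.swap₁₂.nbCount_eq_two hc, if_pos hcb.symm] at hc2
  have hc3 := nbCount_mono (G := G) (hXe b (by simp)) c
  have hb2 : nbCount G b X = 0 := by
    obtain ⟨z, -, -, hz⟩ := exists_other_neighbor (h.swap₁₂.nbCount_eq_two hc) haA hab
    have hcz := (hz c hcA).1 hcb
    rw [nbCount_eq_zero]
    intro y hy hby
    have := (hz y (hXA hy)).1 hby
    simp only [hX, Finset.mem_sdiff, Finset.mem_insert, Finset.mem_singleton] at hy
    grind
  have hX1 : X.card ≤ 1 := by omega
  ext x
  simp only [Finset.mem_insert, Finset.mem_singleton]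
  constructor
  · intro hx
    by_cases hxX : x ∈ X
    · have := Finset.card_le_one.1 hX1 x hxX d hdX
      tauto
    · simp only [hX, Finset.mem_sdiff, Finset.mem_insert, Finset.mem_singleton] at hxX
      tauto
  · rintro (rfl | rfl | rfl | rfl) <;> assumption

end Uniqueness

section Ladder

variable {G : SimpleGraph V}

lemma isLadder_pair {a b : V} (h : G.Adj a b) : IsLadder G {a, b} s(a, b) s(a, b) := by
  refine ⟨0, fun _ => a, fun _ => b, fun i j _ => Fin.ext (by omega),
    fun i j _ => Fin.ext (by omega), fun _ _ => h.ne, ?_, ?_, rfl, rfl⟩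
  · rw [Set.range_const, Set.range_const, Set.singleton_union]
  rintro u (rfl | rfl) v (rfl | rfl) <;> simp [h, h.symm, h.ne, h.ne']

lemma IsLadder.insert {A : Set V} {u v s t : V} {f : Sym2 V} (h : IsLadder G A s(s, t) f)
    (hu : u ∉ A) (hv : v ∉ A) (huv : G.Adj u v)
    (hus : ∀ z ∈ A, G.Adj u z ↔ z = s) (hvt : ∀ z ∈ A, G.Adj v z ↔ z = t) :
    IsLadder G (insert u (insert v A)) s(u, v) f := by
  obtain ⟨k, x, y, hx, hy, hxy, rfl, hadj, h1, rfl⟩ := h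
  wlog hst : s = x 0 ∧ t = y 0 generalizing u v s t
  · have := this huv.symm hv hu hvt hus (by rw [← h1, Sym2.eq_swap]) (by
      rcases Sym2.eq_iff.1 h1 with h | h <;> tauto)
    rwa [Sym2.eq_swap, Set.insert_comm]
  obtain ⟨rfl, rfl⟩ := hst
  have hux (i) : u ≠ x i := fun e => hu (by simp [e])
  have huy (i) : u ≠ y i := fun e => hu (by simp [e])
  have hvx (i) : v ≠ x i := fun e => hv (by simp [e])
  have hvy (i) : v ≠ y i := fun e => hv (by simp [e])
  have hcs (i : Fin k) : i.succ.castSucc = i.castSucc.succ := (Fin.succ_castSucc i).symm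
  refine ⟨k + 1, Fin.cons u x, Fin.cons v y, ?_, ?_, ?_, ?_, ?_, rfl, ?_⟩
  · rw [Fin.cons_injective_iff]
    exact ⟨by rintro ⟨i, hi⟩; exact hux i hi.symm, hx⟩
  · rw [Fin.cons_injective_iff]
    exact ⟨by rintro ⟨i, hi⟩; exact hvy i hi.symm, hy⟩
  · intro i j
    cases i using Fin.cases <;> cases j using Fin.cases <;>
      simp [huv.ne, huy, hxy, (hvx _).symm]
  · rw [Fin.range_cons, Fin.range_cons]
    ext z
    simp only [Set.mem_insert_iff, Set.mem_union]
    tauto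
  · have hz (z) (hz : z ∈ Set.range x ∪ Set.range y) : z ≠ u ∧ z ≠ v :=
      ⟨fun e => hu (e ▸ hz), fun e => hv (e ▸ hz)⟩
    simp only [Fin.exists_fin_succ, Fin.cons_zero, Fin.cons_succ, Fin.castSucc_zero, hcs]
    rintro p (rfl | rfl | hp) q (rfl | rfl | hq)
    · simp [huv.ne, hux, huy]
    · simp [huv, huv.ne, hux, huy]
    · have := hus q hq
      have := hz q hq
      simp [*, huv.ne]
    · simp [huv.symm, huv.ne, hvx, hvy, huv.ne']
    · simp [huv.ne', hvx, hvy]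
    · have := hvt q hq
      have := hz q hq
      simp [*, huv.ne']
    · have := hus p hp
      have := hz p hp
      rw [G.adj_comm]
      simp [*, huv.ne]
    · have := hvt p hp
      have := hz p hp
      rw [G.adj_comm]
      simp [*, huv.ne']
    · rw [hadj p hp q hq]
      have := hz p hp
      have := hz q hq
      simp [*, Fin.exists_fin_succ]
  · simp [← Fin.succ_last]

end Ladder

section Induction

variable {G : SimpleGraph V} [Fintype V]

lemma HasLargeCuts.mono {A B : Finset V} (h : HasLargeCuts G A) (hBA : B ⊆ A) :
    HasLargeCuts G B := fun X hX => h X (hX.trans hBA)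

lemma isLadder_of_isNearPM_unique (hc : CubicGraph G) {A I : Finset V} {a b c d : V}
    (hK : HasLargeCuts G A) (h : FourEnds G A a b c d) (hI : IsBipartition G A I)
    (ha : a ∈ I) (hb : b ∈ I) (hcI : c ∉ I) (hdI : d ∉ I)
    (huniq : ∀ M M', IsNearPM G A {d, b} M → IsNearPM G A {d, b} M' → M = M') :
    IsLadder G A s(a, d) s(c, b) := by
  induction A using Finset.strongInduction generalizing I a b c d with
  | H A ih =>
  have had := adj_of_isNearPM_unique hc hK h hI ha hb hcI hdI huniq
  obtain ⟨haA, hbA, hcA, hdA⟩ := h.mem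
  obtain ⟨nab, nac, nad, nbc, nbd, ncd⟩ := h.ne
  have ha2 := h.nbCount_eq_two hc
  have hd2 := h.swap₃₄.swap₂₃.swap₁₂.nbCount_eq_two hc
  obtain ⟨a', ha'A, ha'd, ha'⟩ := exists_other_neighbor ha2 hdA had
  obtain ⟨d', hd'A, hd'a, hd'⟩ := exists_other_neighbor hd2 haA had.symm
  have haa' : G.Adj a a' := (ha' a' ha'A).2 (.inr rfl)
  have hdd' : G.Adj d d' := (hd' d' hd'A).2 (.inr rfl)
  have ha'I : a' ∉ I := (hI.2 a haA a' ha'A haa').1 ha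
  have hd'I : d' ∈ I := by
    have := hI.2 d hdA d' hd'A hdd'
    tauto
  set A' := (A.erase a).erase d with hA'
  have hmem (x) : x ∈ A' ↔ x ≠ d ∧ x ≠ a ∧ x ∈ A := by simp [hA']
  clear_value A'
  have hA'A : A' ⊆ A := fun x hx => ((hmem x).1 hx).2.2
  have hAA' : (A : Set V) = insert a (insert d (A' : Set V)) := by
    ext x
    simp only [Finset.mem_coe, Set.mem_insert_iff, hmem]
    grind
  suffices hL : IsLadder G A' s(a', d') s(c, b) by
    rw [hAA']
    refine hL.insert (by simp [hmem]) (by simp [hmem]) had ?_ ?_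
    · intro z hz
      have hz' := (hmem z).1 hz
      rw [ha' z hz'.2.2]
      tauto
    · intro z hz
      have hz' := (hmem z).1 hz
      rw [hd' z hz'.2.2]
      tauto
  by_cases hcorner : a' = c ∨ d' = b
  · have hAeq : A = {a, b, c, d} := by
      rcases hcorner with rfl | rfl
      · have := h.swap₂₃.swap₃₄.swap₂₃.swap₁₂.eq_of_adj_of_adj hc hK had haa'
        rw [this]; ext; simp; tauto
      · have := h.swap₃₄.swap₂₃.eq_of_adj_of_adj hc hK had.symm hdd'
        rw [this]; ext; simp; tauto
    have ha'c : a' = c := by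
      have := haa'.ne
      subst hAeq
      simp only [Finset.mem_insert, Finset.mem_singleton] at ha'A
      grind
    have hd'b : d' = b := by
      have := hdd'.ne
      subst hAeq
      simp only [Finset.mem_insert, Finset.mem_singleton] at hd'A
      grind
    subst ha'c hd'b
    have hA'eq : (A' : Set V) = {a', d'} := by
      ext x
      simp only [Finset.mem_coe, Set.mem_insert_iff, Set.mem_singleton_iff, hmem, hAeq,
        Finset.mem_insert, Finset.mem_singleton]
      grind
    rw [hA'eq]
    apply isLadder_pair
    obtain ⟨z, hz, hza, hzadj⟩ := exists_other_neighbor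
      (h.swap₂₃.swap₁₂.nbCount_eq_two hc) haA haa'.symm
    have h1 := (hzadj z hz).2 (.inr rfl)
    have h2 := hI.2 a' hcA z hz h1
    rw [hAeq] at hz
    simp only [Finset.mem_insert, Finset.mem_singleton] at hz
    have : z = d' := by grind
    exact this ▸ h1
  push Not at hcorner
  obtain ⟨ha'c, hd'b⟩ := hcorner
  have ha'A' : a' ∈ A' := (hmem _).2 ⟨ha'd, haa'.ne', ha'A⟩
  have hd'A' : d' ∈ A' := (hmem _).2 ⟨hdd'.ne', hd'a, hd'A⟩
  have hbA' : b ∈ A' := (hmem _).2 ⟨nbd, nab.symm, hbA⟩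
  have hcA' : c ∈ A' := (hmem _).2 ⟨ncd, nac.symm, hcA⟩
  have hE : FourEnds G A' d' b c a' := by
    refine ⟨⟨hd'A', hbA', hcA', ha'A'⟩, ⟨hd'b, fun e => hcI (e ▸ hd'I), fun e => ha'I (e ▸ hd'I),
      nbc, fun e => ha'I (e ▸ hb), ha'c.symm⟩, fun x hx => ?_⟩
    have hx' := (hmem x).1 hx
    have e : A'ᶜ = insert a (insert d Aᶜ) := by
      ext y
      simp only [Finset.mem_compl, hmem, Finset.mem_insert]
      grind
    rw [e, nbCount_insert (by simp [nad, haA]), nbCount_insert (by simp [hdA]), h.out x hx'.2.2,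
      G.adj_comm x a, G.adj_comm x d, ha' x hx'.2.2, hd' x hx'.2.2]
    have : a' ≠ d' := fun e => ha'I (e ▸ hd'I)
    have : a' ≠ b := fun e => ha'I (e ▸ hb)
    have : d' ≠ c := fun e => hcI (e ▸ hd'I)
    simp only [hx'.1, hx'.2.1, false_or, or_false]
    grind
  have hI' : IsBipartition G A' (I.erase a) := by
    refine ⟨fun x hx => ?_, fun x hx y hy hxy => ?_⟩
    · rw [Finset.mem_erase] at hx
      exact (hmem x).2 ⟨fun e => hdI (e ▸ hx.2), hx.1, hI.1 hx.2⟩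
    · have hx' := (hmem x).1 hx
      have hy' := (hmem y).1 hy
      simp only [Finset.mem_erase, hx'.2.1, hy'.2.1, ne_eq, not_false_eq_true, true_and]
      exact hI.2 x hx'.2.2 y hy'.2.2 hxy
  have hnota {M} (hM : IsNearPM G A' {a', b} M) (e) (he : e ∈ M) (z) (hz : z ∈ e) : z ∈ A' := by
    obtain ⟨x, y, rfl, -, hx, hy⟩ := hM.1 e he
    rcases Sym2.mem_iff.1 hz with rfl | rfl
    exacts [hx, hy]
  have haA' : a ∉ A' := by simp [hmem]
  have hdA' : d ∉ A' := by simp [hmem]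
  have hext {M} (hM : IsNearPM G A' {a', b} M) : IsNearPM G A {d, b} (insert s(a, a') M) := by
    refine ⟨?_, ?_, ?_⟩
    · rintro e (rfl | he)
      · exact ⟨a, a', rfl, haa', haA, ha'A⟩
      · obtain ⟨x, y, rfl, hxy, hx, hy⟩ := hM.1 e he
        exact ⟨x, y, rfl, hxy, hA'A hx, hA'A hy⟩
    · rintro w ⟨hwA, hw⟩
      simp only [Set.mem_insert_iff, Set.mem_singleton_iff, not_or] at hw
      by_cases hwa : w = a ∨ w = a'
      · refine ⟨s(a, a'), ⟨.inl rfl, Sym2.mem_iff.2 hwa⟩, ?_⟩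
        rintro e ⟨rfl | he, hwe⟩
        · rfl
        · rcases hwa with rfl | rfl
          · exact (haA' (hnota hM e he _ hwe)).elim
          · exact (hM.2.2 w (by simp) e he hwe).elim
      · push Not at hwa
        obtain ⟨e, ⟨he, hwe⟩, heu⟩ := hM.2.1 w ⟨(hmem w).2 ⟨hw.1, hwa.1, hwA⟩, by simp [*]⟩
        refine ⟨e, ⟨.inr he, hwe⟩, ?_⟩
        rintro e' ⟨rfl | he', hwe'⟩
        · exact (by simp [hwa] at hwe' : False).elim
        · exact heu e' ⟨he', hwe'⟩
    · rintro w (rfl | rfl) e (rfl | he) hwe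
      · simp [nad.symm, ha'd.symm] at hwe
      · exact hdA' (hnota hM e he _ hwe)
      · rcases Sym2.mem_iff.1 hwe with rfl | rfl
        · exact nab rfl
        · exact ha'I hb
      · exact hM.2.2 w (by simp) e he hwe
  have hsub : A' ⊂ A := Finset.ssubset_iff_subset_ne.2 ⟨hA'A, fun e => haA' (e ▸ haA)⟩
  rw [Sym2.eq_swap]
  refine ih A' hsub (hK.mono hA'A) hE hI' (by simp [hd'I, hd'a]) (by simp [hb, nab.symm])
    (by simp [hcI]) (by simp [ha'I]) fun M M' hM hM' => ?_
  have hMM' := huniq _ _ (hext hM) (hext hM')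
  have hnot {N} (hN : IsNearPM G A' {a', b} N) : s(a, a') ∉ N := fun he =>
    haA' (hnota hN _ he a (by simp))
  rw [← Set.insert_sdiff_self_of_notMem (hnot hM), hMM', Set.insert_sdiff_self_of_notMem (hnot hM')]

end Induction

section Finiteness

variable {G : SimpleGraph V}

lemma exists_finset_of_not_isAcyclic {A : Set V} (h : ¬(G.induce A).IsAcyclic) :
    ∃ F : Finset V, ↑F ⊆ A ∧ ∀ S : Set V, ↑F ⊆ S → ¬(G.induce S).IsAcyclic := by
  rw [isAcyclic_iff_free_cycleGraph] at h
  push Not at h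
  obtain ⟨n, hn, h⟩ := h
  obtain ⟨f⟩ := h
  refine ⟨Finset.univ.image fun i => (f i : V), by simp [Set.range_subset_iff], fun S hS hac => ?_⟩
  have hfS (i) : (f i : V) ∈ S := hS (by simp)
  refine isAcyclic_iff_free_cycleGraph.1 hac n hn
    ⟨⟨⟨fun i => ⟨f i, hfS i⟩, fun hij => f.toHom.map_adj hij⟩, fun i j hij => ?_⟩⟩
  exact f.injective (Subtype.ext (congrArg (fun z : S => (z : V)) hij))

lemma CubicGraph.finite_of_cyclicCut (hc : CubicGraph G) {k : ℕ} (hk : 0 < k)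
    (hG : CyclicallyEdgeConnected G k) {A : Set V} (hA : CyclicCut G A) : Finite V := by
  by_contra hinf
  rw [not_finite_iff_infinite] at hinf
  have hN (x) : (G.neighborSet x).Finite := Set.finite_of_ncard_ne_zero (by rw [hc x]; simp)
  obtain ⟨F₁, hF₁A, hF₁⟩ := exists_finset_of_not_isAcyclic hA.1
  obtain ⟨F₂, hF₂A, hF₂⟩ := exists_finset_of_not_isAcyclic hA.2
  have hNF (F : Finset V) : (⋃ x ∈ F, G.neighborSet x).Finite :=
    F.finite_toSet.biUnion fun x _ => hN x
  have : Std.Symm fun x y : V => ¬G.Adj x y ∧ x ≠ y :=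
    ⟨fun x y h => ⟨fun h' => h.1 h'.symm, h.2.symm⟩⟩
  obtain ⟨f, hfP, hf⟩ := exists_seq_of_forall_finset_exists'
    (fun y => y ∉ F₂ ∧ ∀ x ∈ F₁, ¬G.Adj x y) (fun x y => ¬G.Adj x y ∧ x ≠ y) (fun s _ => by
      obtain ⟨y, hy⟩ := ((hNF F₁).union ((hNF s).union (F₂ ∪ s).finite_toSet)).exists_notMem
      simp only [Set.mem_union, Set.mem_iUnion, mem_neighborSet, Finset.coe_union,
        Finset.mem_coe, exists_prop, not_or, not_exists, not_and] at hy
      exact ⟨y, ⟨hy.2.2.1, hy.1⟩, fun x hx => ⟨hy.2.1 x hx, fun e => hy.2.2.2 (e ▸ hx)⟩⟩)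
  have hg (n) : ∃ y, G.Adj (f n) y :=
    Set.nonempty_of_ncard_ne_zero (s := G.neighborSet (f n)) (by rw [hc]; simp)
  choose g hg using hg
  set S : Set V := ↑F₁ ∪ Set.range f with hS
  have hgS (n) : g n ∉ S := by
    rintro (h | ⟨m, hm⟩)
    · exact (hfP n).2 _ h (hg n).symm
    · have hnm : n ≠ m := by
        rintro rfl
        exact (hg n).ne hm
      exact (hf hnm).1 (hm ▸ hg n)
  have hcut : CyclicCut G S := by
    refine ⟨hF₁ S Set.subset_union_left, hF₂ Sᶜ fun x hx => ?_⟩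
    rintro (h | ⟨m, rfl⟩)
    · exact hF₂A hx (hF₁A h)
    · exact (hfP m).1 hx
  have hcutinf : (cutEdges G S).Infinite := by
    refine Set.infinite_of_injective_forall_mem (f := fun n => s(f n, g n)) (fun m n hmn => ?_)
      fun n => ⟨hg n, f n, g n, rfl, .inr ⟨n, rfl⟩, hgS n⟩
    rcases Sym2.eq_iff.1 hmn with h | h
    · by_contra hne
      exact (hf hne).2 h.1
    · exact (hgS n (.inr ⟨m, h.1⟩)).elim
  have := hG S hcut
  rw [hcutinf.ncard] at this
  omega

end Finiteness

lemma CyclicallyEdgeConnected.hasLargeCuts [Fintype V] {G : SimpleGraph V} (hc : CubicGraph G)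
    (hG : CyclicallyEdgeConnected G 4) {A : Finset V} (hA : ¬(G.induce (A : Set V)ᶜ).IsAcyclic) :
    HasLargeCuts G A := by
  intro X hXA hX
  by_cases hac : (G.induce (X : Set V)).IsAcyclic
  · exact .inr (card_add_two_le_of_isAcyclic hc hX hac)
  · obtain ⟨F, hFA, hF⟩ := exists_finset_of_not_isAcyclic hA
    rw [← ncard_cutEdges]
    exact .inl (hG _ ⟨hac, hF _ (hFA.trans (Set.compl_subset_compl.2 (Finset.coe_subset.2 hXA)))⟩)

lemma fourEnds_of_cutEdges_eq [Fintype V] {G : SimpleGraph V} {A : Finset V}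
    {v₁ v₂ v₃ v₄ w₁ w₂ w₃ w₄ : V}
    (hv : v₁ ≠ v₂ ∧ v₁ ≠ v₃ ∧ v₁ ≠ v₄ ∧ v₂ ≠ v₃ ∧ v₂ ≠ v₄ ∧ v₃ ≠ v₄)
    (hvA : v₁ ∈ A ∧ v₂ ∈ A ∧ v₃ ∈ A ∧ v₄ ∈ A)
    (hwA : w₁ ∉ A ∧ w₂ ∉ A ∧ w₃ ∉ A ∧ w₄ ∉ A)
    (hcut : cutEdges G A = {s(v₁, w₁), s(v₂, w₂), s(v₃, w₃), s(v₄, w₄)}) :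
    FourEnds G A v₁ v₂ v₃ v₄ := by
  refine ⟨hvA, hv, fun x hx => ?_⟩
  have key (y) (hy : y ∉ A) : G.Adj x y ↔ (x = v₁ ∧ y = w₁) ∨ (x = v₂ ∧ y = w₂) ∨
      (x = v₃ ∧ y = w₃) ∨ (x = v₄ ∧ y = w₄) := by
    have h1 : G.Adj x y ↔ s(x, y) ∈ cutEdges G A :=
      ⟨fun h => ⟨h, x, y, rfl, hx, hy⟩, fun h => h.1⟩
    rw [h1, hcut]
    simp only [Set.mem_insert_iff, Set.mem_singleton_iff, Sym2.eq_iff]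
    grind
  have hone (w) (hw : w ∉ A) (h : ∀ y ∉ A, G.Adj x y ↔ y = w) : nbCount G x Aᶜ = 1 := by
    rw [nbCount, Finset.card_eq_one]
    refine ⟨w, ?_⟩
    ext y
    simp only [Finset.mem_filter, Finset.mem_compl, Finset.mem_singleton]
    grind
  split_ifs with h
  · rcases h with rfl | rfl | rfl | rfl
    · exact hone w₁ hwA.1 fun y hy => by rw [key y hy]; grind
    · exact hone w₂ hwA.2.1 fun y hy => by rw [key y hy]; grind
    · exact hone w₃ hwA.2.2.1 fun y hy => by rw [key y hy]; grind
    · exact hone w₄ hwA.2.2.2 fun y hy => by rw [key y hy]; grind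
  · rw [nbCount_eq_zero]
    intro y hy
    rw [key y (Finset.mem_compl.1 hy)]
    grind

lemma FourEnds.congr [Fintype V] {G : SimpleGraph V} {A : Finset V} {a b c d p q r : V}
    (h : FourEnds G A a b c d) (hpqr : ({p, q, r} : Set V) = {b, c, d}) (hpq : p ≠ q)
    (hpr : p ≠ r) (hqr : q ≠ r) : FourEnds G A a r p q := by
  have hmem (x) : (x = p ∨ x = q ∨ x = r) ↔ (x = b ∨ x = c ∨ x = d) := by
    simpa using Set.ext_iff.1 hpqr x
  have hp := (hmem p).1 (by simp)
  have hq := (hmem q).1 (by simp)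
  have hr := (hmem r).1 (by simp)
  have h1 := h.mem
  have h2 := h.ne
  refine ⟨by grind, by grind, fun x hx => ?_⟩
  rw [h.out x hx]
  have := hmem x
  congr 1
  grind

/-- Lemma on cyclic 4-edge-cuts and ladders. Let `E(A, Aᶜ)` be a cyclic 4-edge-cut of
a cyclically 4-edge-connected cubic graph `G`, with cut edges `s(vᵢ, wᵢ)`, `vᵢ ∈ A`.
For `p, q ∈ {v₂, v₃, v₄}` let `g p q` be the number of matchings of `G[A]` covering
all vertices of `A` except `p` and `q`.  If one of the three numbers `g p q`
(`{p,q,r} = {v₂,v₃,v₄}`) is zero, then either the other two are at least two, or one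
of them is one and `G[A]` is a ladder with the corresponding ends. -/
theorem cyclic_four_cut_ladder
    (G : SimpleGraph V) (hcubic : CubicGraph G)
    (hC4 : CyclicallyEdgeConnected G 4)
    (A : Set V) (hcyc : CyclicCut G A)
    (v₁ v₂ v₃ v₄ w₁ w₂ w₃ w₄ : V)
    (hv12 : v₁ ≠ v₂) (hv13 : v₁ ≠ v₃) (hv14 : v₁ ≠ v₄)
    (hv23 : v₂ ≠ v₃) (hv24 : v₂ ≠ v₄) (hv34 : v₃ ≠ v₄)
    (hvA : v₁ ∈ A ∧ v₂ ∈ A ∧ v₃ ∈ A ∧ v₄ ∈ A)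
    (hwA : w₁ ∉ A ∧ w₂ ∉ A ∧ w₃ ∉ A ∧ w₄ ∉ A)
    (hadj : G.Adj v₁ w₁ ∧ G.Adj v₂ w₂ ∧ G.Adj v₃ w₃ ∧ G.Adj v₄ w₄)
    (hcut : cutEdges G A = {s(v₁, w₁), s(v₂, w₂), s(v₃, w₃), s(v₄, w₄)}) :
    ∀ p q r : V, ({p, q, r} : Set V) = {v₂, v₃, v₄} →
      p ≠ q → p ≠ r → q ≠ r →
      {M : Set (Sym2 V) | IsNearPM G A {p, q} M}.ncard = 0 →
      (2 ≤ {M : Set (Sym2 V) | IsNearPM G A {p, r} M}.ncard ∧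
       2 ≤ {M : Set (Sym2 V) | IsNearPM G A {q, r} M}.ncard) ∨
      ({M : Set (Sym2 V) | IsNearPM G A {p, r} M}.ncard = 1 ∧
        IsLadder G A s(v₁, p) s(q, r)) ∨
      ({M : Set (Sym2 V) | IsNearPM G A {q, r} M}.ncard = 1 ∧
        IsLadder G A s(v₁, q) s(p, r)) := by
  intro p q r hpqr hpq hpr hqr h0
  have := hcubic.finite_of_cyclicCut four_pos hC4 hcyc
  have := Fintype.ofFinite V
  lift A to Finset V using A.toFinite
  have hK := hC4.hasLargeCuts hcubic hcyc.2
  have h : FourEnds G A v₁ r p q :=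
    (fourEnds_of_cutEdges_eq ⟨hv12, hv13, hv14, hv23, hv24, hv34⟩ hvA hwA hcut).congr
      hpqr hpq hpr hqr
  rw [Set.ncard_eq_zero] at h0
  obtain ⟨I, hI, h1I, hrI, hpI, hqI⟩ := exists_isBipartition hcubic hK h
    fun ⟨M, hM⟩ => (Set.eq_empty_iff_forall_notMem.1 h0 M hM).elim
  have huniq {X : Set V} (hX : {M : Set (Sym2 V) | IsNearPM G A X M}.ncard = 1) :
      ∀ M M', IsNearPM G A X M → IsNearPM G A X M' → M = M' :=
    fun _ _ hM hM' => (Set.ncard_le_one).1 hX.le _ hM _ hM'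
  have hprpos : 0 < {M : Set (Sym2 V) | IsNearPM G A {p, r} M}.ncard := (Set.ncard_pos).2
    (exists_isNearPM_of_isBipartition hcubic hK h.swap₃₄ hI h1I hrI hqI hpI)
  have hqrpos : 0 < {M : Set (Sym2 V) | IsNearPM G A {q, r} M}.ncard := (Set.ncard_pos).2
    (exists_isNearPM_of_isBipartition hcubic hK h hI h1I hrI hpI hqI)
  by_cases hpr1 : {M : Set (Sym2 V) | IsNearPM G A {p, r} M}.ncard = 1
  · exact .inr (.inl ⟨hpr1,
      isLadder_of_isNearPM_unique hcubic hK h.swap₃₄ hI h1I hrI hqI hpI (huniq hpr1)⟩)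
  by_cases hqr1 : {M : Set (Sym2 V) | IsNearPM G A {q, r} M}.ncard = 1
  · exact .inr (.inr ⟨hqr1,
      isLadder_of_isNearPM_unique hcubic hK h hI h1I hrI hpI hqI (huniq hqr1)⟩)
  exact .inl ⟨by omega, by omega⟩
end
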